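/- Let G₁ and G₂ be discrete convergence groups acting on a compact metrizable space M, suppose J = G₁ ∩ G₂ is geometrically finite and a proper subgroup of both G₁ and G₂, suppose G₁ and G₂ are in AFP ping-pong position with respect to J, and let G = ⟨G₁, G₂⟩ act on M as a convergence group. If both G₁ and G₂ are geometrically finite, then every parabolic point of G lying in Λ(G₁) ∪ Λ(G₂) is a bounded parabolic point for the action of G on Λ(G). -/

import Mathlib

open Filter Topology Set

namespace ConvergenceGroups

variable {M : Type*} [TopologicalSpace M]

/-- The group of self-homeomorphisms of `M`, with `(g * h) x = g (h x)`. -/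
instance : Group (M ≃ₜ M) where
  mul g h := h.trans g
  one := Homeomorph.refl M
  inv := Homeomorph.symm
  mul_assoc _ _ _ := rfl
  one_mul _ := Homeomorph.ext fun _ => rfl
  mul_one _ := Homeomorph.ext fun _ => rfl
  inv_mul_cancel g := Homeomorph.ext fun x => g.symm_apply_apply x

/-- The inclusion of the self-homeomorphisms of `M` into the continuous self-maps of `M`;
the latter carries the compact-open topology. -/
def toCM (g : M ≃ₜ M) : C(M, M) := ⟨⇑g, g.continuous⟩

/-- `(g k)` is a convergence sequence with attracting point `zp` and repelling point `zm`:
the maps `g k` converge to the constant map `zp` uniformly on compact subsets of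
`M ∖ {zm}`. -/
def IsConvSeq (g : ℕ → M ≃ₜ M) (zp zm : M) : Prop :=
  ∀ K : Set M, IsCompact K → zm ∉ K → ∀ U ∈ 𝓝 zp,
    ∀ᶠ k in atTop, ∀ x ∈ K, g k x ∈ U

/-- `(g k)` converges in the compact-open topology to a homeomorphism. -/
def TendstoHomeo (g : ℕ → M ≃ₜ M) : Prop :=
  ∃ h : M ≃ₜ M, Tendsto (fun k => toCM (g k)) atTop (𝓝 (toCM h))

/-- `G` acts on `M` as a convergence group: every sequence of pairwise distinct elements of
`G` has a subsequence which either converges in the compact-open topology to a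
homeomorphism, or is a convergence sequence. -/
def IsConvGroup (G : Subgroup (M ≃ₜ M)) : Prop :=
  ∀ g : ℕ → M ≃ₜ M, (∀ k, g k ∈ G) → Function.Injective g →
    ∃ φ : ℕ → ℕ, StrictMono φ ∧
      (TendstoHomeo (g ∘ φ) ∨ ∃ zp zm : M, IsConvSeq (g ∘ φ) zp zm)

/-- `G` acts on `M` as a discrete convergence group: every sequence of pairwise distinct
elements of `G` has a subsequence which is a convergence sequence. -/
def IsDiscreteConvGroup (G : Subgroup (M ≃ₜ M)) : Prop :=
  ∀ g : ℕ → M ≃ₜ M, (∀ k, g k ∈ G) → Function.Injective g →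
    ∃ φ : ℕ → ℕ, StrictMono φ ∧ ∃ zp zm : M, IsConvSeq (g ∘ φ) zp zm

/-- The limit set `Λ(G)`: the set of all attracting points of convergence sequences in `G`. -/
def limitSet (G : Subgroup (M ≃ₜ M)) : Set M :=
  {zp | ∃ g : ℕ → M ≃ₜ M, (∀ k, g k ∈ G) ∧ Function.Injective g ∧
    ∃ zm : M, IsConvSeq g zp zm}

/-- `x` is a conical limit point for `G`: there is a sequence of pairwise distinct elements
`g k` of `G` such that for every `z ≠ x` the pairs `(g k x, g k z)` remain in a compact
subset of `(M × M) ∖ Δ`. -/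
def IsConicalLimitPt (G : Subgroup (M ≃ₜ M)) (x : M) : Prop :=
  ∃ g : ℕ → M ≃ₜ M, (∀ k, g k ∈ G) ∧ Function.Injective g ∧
    ∀ z : M, z ≠ x → ∃ K : Set (M × M), IsCompact K ∧ (∀ p ∈ K, p.1 ≠ p.2) ∧
      ∀ k, (g k x, g k z) ∈ K

/-- `g` is elliptic: the closure of the cyclic group generated by `g` is compact in
`Homeo(M)` (viewed inside `C(M, M)` with the compact-open topology). -/
def IsEllipticElem (g : M ≃ₜ M) : Prop :=
  IsCompact (closure (Set.range fun n : ℤ => toCM (g ^ n))) ∧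
    closure (Set.range fun n : ℤ => toCM (g ^ n)) ⊆ Set.range (toCM (M := M))

/-- `g` is parabolic: not elliptic, and fixes exactly one point of `M`. -/
def IsParabolicElem (g : M ≃ₜ M) : Prop :=
  ¬IsEllipticElem g ∧ ∃! x : M, g x = x

/-- `g` is loxodromic: not elliptic, and fixes exactly two points of `M`. -/
def IsLoxodromicElem (g : M ≃ₜ M) : Prop :=
  ¬IsEllipticElem g ∧ ∃ a b : M, a ≠ b ∧ {x : M | g x = x} = {a, b}

/-- `p` is a parabolic point for `G`: it is the fixed point of a parabolic element of `G`. -/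
def IsParabolicPt (G : Subgroup (M ≃ₜ M)) (p : M) : Prop :=
  ∃ g ∈ G, IsParabolicElem g ∧ g p = p

/-- `p` is a bounded parabolic point for `G`: it is a parabolic point and the quotient of
`Λ(G) ∖ {p}` by the stabilizer of `p` in `G` is compact. -/
def IsBoundedParabolicPt (G : Subgroup (M ≃ₜ M)) (p : M) : Prop :=
  IsParabolicPt G p ∧
    ∃ K : Set M, IsCompact K ∧ K ⊆ limitSet G \ {p} ∧
      ∀ x ∈ limitSet G \ {p}, ∃ h ∈ G, h p = p ∧ h x ∈ K

/-- `G` is geometrically finite: every point of `Λ(G)` is a conical limit point or a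
bounded parabolic point. -/
def IsGeomFinite (G : Subgroup (M ≃ₜ M)) : Prop :=
  ∀ x ∈ limitSet G, IsConicalLimitPt G x ∨ IsBoundedParabolicPt G x

/-- `J` is a fully quasi-convex subgroup of `G`: `J ≤ G`, `J` acts geometrically finitely,
and `g Λ(J) ∩ Λ(J) = ∅` for all but finitely many left cosets `gJ`. -/
def IsFullyQuasiconvex (G J : Subgroup (M ≃ₜ M)) : Prop :=
  J ≤ G ∧ IsGeomFinite J ∧
    ∃ F : Set (M ≃ₜ M), F.Finite ∧ ∀ g ∈ G,
      (⇑g '' limitSet J ∩ limitSet J).Nonempty → ∃ f ∈ F, ∃ j ∈ J, g = f * j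

/-- `G₁` and `G₂` are in AFP ping-pong position with respect to `J = G₁ ∩ G₂`, witnessed by
the closed sets `B₁`, `B₂`. -/
structure AFPPingPong (G₁ G₂ J : Subgroup (M ≃ₜ M)) (B₁ B₂ : Set M) : Prop where
  isClosed₁ : IsClosed B₁
  isClosed₂ : IsClosed B₂
  int_nonempty₁ : (interior B₁).Nonempty
  int_nonempty₂ : (interior B₂).Nonempty
  int_disjoint : interior B₁ ∩ interior B₂ = ∅
  inv₁ : ∀ j ∈ J, ⇑j '' B₁ = B₁
  inv₂ : ∀ j ∈ J, ⇑j '' B₂ = B₂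
  pp₁ : ∀ g ∈ G₁, g ∉ J → ⇑g '' B₁ ⊆ interior B₂
  pp₂ : ∀ g ∈ G₂, g ∉ J → ⇑g '' B₂ ⊆ interior B₁
  lim₁ : limitSet G₁ \ limitSet J ⊆ interior B₂
  lim₂ : limitSet G₂ \ limitSet J ⊆ interior B₁

/-- `G₀` is in HNN ping-pong position with respect to `f`, `J₁`, `J₋₁`, witnessed by the
closed sets `B₁`, `Bm` (where `Bm` plays the role of `B₋₁`). -/
structure HNNPingPong (G₀ J₁ Jm : Subgroup (M ≃ₜ M)) (f : M ≃ₜ M) (B₁ Bm : Set M) :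
    Prop where
  isClosed₁ : IsClosed B₁
  isClosedm : IsClosed Bm
  int_nonempty₁ : (interior B₁).Nonempty
  int_nonemptym : (interior Bm).Nonempty
  int_disjoint : interior B₁ ∩ interior Bm = ∅
  inv₁ : ∀ j ∈ J₁, ⇑j '' B₁ = B₁
  invm : ∀ j ∈ Jm, ⇑j '' Bm = Bm
  prec₁ : ∀ g ∈ G₀, g ∉ J₁ → ⇑g '' B₁ ∩ B₁ = ∅
  precm : ∀ g ∈ G₀, g ∉ Jm → ⇑g '' Bm ∩ Bm = ∅
  cross : ∀ g ∈ G₀, ⇑g '' B₁ ∩ Bm = ∅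
  mapf : ⇑f '' ((B₁ ∪ Bm)ᶜ ∪ B₁) = interior B₁
  lim₁ : limitSet G₀ ∩ B₁ = limitSet J₁
  limm : limitSet G₀ ∩ Bm = limitSet Jm
  proper : (⋃ g ∈ G₀, ⇑g '' (B₁ ∪ Bm))ᶜ.Nonempty

/-- A letter of type `i` (`i = 0` for `G₁`, `i = 1` for `G₂`) for amalgamated free product
normal forms: an element of `G_{i+1} ∖ J`. -/
def AFPLetter (G₁ G₂ J : Subgroup (M ≃ₜ M)) (i : Fin 2) (g : M ≃ₜ M) : Prop :=
  g ∈ (if i = 0 then G₁ else G₂) ∧ g ∉ J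

/-- `h` is an `(i,j)`-form: a product of a nonempty alternating list of letters, whose first
letter lies in `G_i ∖ J` and whose last letter lies in `G_j ∖ J` (indices shifted so that
`0` stands for `G₁` and `1` for `G₂`). -/
def IsIJForm (G₁ G₂ J : Subgroup (M ≃ₜ M)) (i j : Fin 2) (h : M ≃ₜ M) : Prop :=
  ∃ l : List (M ≃ₜ M), l ≠ [] ∧ l.prod = h ∧
    (∀ g ∈ l, AFPLetter G₁ G₂ J 0 g ∨ AFPLetter G₁ G₂ J 1 g) ∧
    l.Chain' (fun a b => ∀ c : Fin 2, AFPLetter G₁ G₂ J c a → AFPLetter G₁ G₂ J (1 - c) b) ∧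
    (∀ hne : l ≠ [], AFPLetter G₁ G₂ J i (l.head hne)) ∧
    (∀ hne : l ≠ [], AFPLetter G₁ G₂ J j (l.getLast hne))

section Basics

theorem exists_ne_ne {M : Type*} [Infinite M] (a b : M) : ∃ x : M, x ≠ a ∧ x ≠ b := by
  obtain ⟨x, hx⟩ := ((Set.toFinite {a, b}).infinite_compl).nonempty
  simp at hx
  exact ⟨x, hx.1, hx.2⟩

theorem exists_injective_forall_mem {α : Type*} {S : ℕ → Set α} (hS : Antitone S)
    (hi : ∀ n, (S n).Infinite) : ∃ f : ℕ → α, Function.Injective f ∧ ∀ n, f n ∈ S n := by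
  classical
  obtain ⟨f, hP, hr⟩ := exists_seq_of_forall_finset_exists
    (fun x : ℕ × α => x.2 ∈ S x.1) (fun x y => x.1 < y.1 ∧ x.2 ≠ y.2) (by
      intro s _
      obtain ⟨a, ha, has⟩ := (hi (s.sup Prod.fst + 1)).exists_notMem_finset (s.image Prod.snd)
      refine ⟨(s.sup Prod.fst + 1, a), ha, fun x hx => ⟨?_, ?_⟩⟩
      · exact Nat.lt_succ_of_le (Finset.le_sup (f := Prod.fst) hx)
      · rintro rfl
        exact has (Finset.mem_image_of_mem _ hx))
  have hm : StrictMono fun n => (f n).1 := fun m n h => (hr m n h).1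
  refine ⟨fun n => (f n).2, fun m n h => ?_, fun n => hS (hm.id_le n) (hP n)⟩
  by_contra hne
  rcases lt_or_gt_of_ne hne with hlt | hlt
  · exact (hr m n hlt).2 h
  · exact (hr n m hlt).2 h.symm

variable {M : Type*} [TopologicalSpace M]

theorem homeo_mul_apply (g h : M ≃ₜ M) (x : M) : (g * h) x = g (h x) := rfl

theorem homeo_inv_apply_self (g : M ≃ₜ M) (x : M) : g⁻¹ (g x) = x := g.symm_apply_apply x

theorem homeo_apply_inv_self (g : M ≃ₜ M) (x : M) : g (g⁻¹ x) = x := g.apply_symm_apply x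

theorem homeo_inv_eq_iff (g : M ≃ₜ M) {x y : M} : g⁻¹ x = y ↔ x = g y :=
  ⟨fun h => by rw [← h, homeo_apply_inv_self], fun h => by rw [h, homeo_inv_apply_self]⟩

theorem exists_strictMono_comp_injective_or_const {α : Type*} (f : ℕ → α) :
    ∃ φ : ℕ → ℕ, StrictMono φ ∧ ((∃ c, ∀ n, f (φ n) = c) ∨ Function.Injective (f ∘ φ)) := by
  obtain ⟨φ, h⟩ := exists_increasing_or_nonincreasing_subseq (· = ·) f
  refine ⟨φ, φ.strictMono, ?_⟩
  rcases h with h | h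
  · left
    refine ⟨f (φ 0), fun n => ?_⟩
    rcases Nat.eq_zero_or_pos n with rfl | hn
    · rfl
    · exact (h 0 n hn).symm
  · right
    intro m n hmn
    by_contra hne
    rcases lt_or_gt_of_ne hne with hlt | hlt
    · exact h m n hlt hmn
    · exact h n m hlt hmn.symm

theorem IsConvSeq.comp {g : ℕ → M ≃ₜ M} {zp zm : M} (h : IsConvSeq g zp zm) {φ : ℕ → ℕ}
    (hφ : Tendsto φ atTop atTop) : IsConvSeq (g ∘ φ) zp zm :=
  fun K hK hzm U hU => hφ.eventually (h K hK hzm U hU)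

theorem isConvSeq_iff [CompactSpace M] [T2Space M] {g : ℕ → M ≃ₜ M} {zp zm : M} :
    IsConvSeq g zp zm ↔ ∀ U ∈ 𝓝 zp, ∀ V ∈ 𝓝 zm, ∀ᶠ k in atTop, ∀ x ∉ V, g k x ∈ U := by
  constructor
  · intro h U hU V hV
    obtain ⟨W, hWV, hW, hzW⟩ := mem_nhds_iff.1 hV
    filter_upwards [h Wᶜ hW.isClosed_compl.isCompact (fun hc => hc hzW) U hU] with k hk x hx
    exact hk x fun hxW => hx (hWV hxW)
  · intro h K hK hzm U hU
    filter_upwards [h U hU Kᶜ (hK.isClosed.isOpen_compl.mem_nhds hzm)] with k hk x hx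
    exact hk x fun hc => hc hx

theorem infinite_of_injective_homeo {g : ℕ → M ≃ₜ M} (hg : Function.Injective g) :
    Infinite M := by
  by_contra hfin
  rw [not_infinite_iff_finite] at hfin
  have : Finite (M ≃ₜ M) := Finite.of_injective (fun h : M ≃ₜ M => (h : M → M))
    DFunLike.coe_injective
  exact not_injective_infinite_finite g hg

theorem IsConvSeq.mem_limitSet {g : ℕ → M ≃ₜ M} {zp zm : M} (h : IsConvSeq g zp zm)
    {G : Subgroup (M ≃ₜ M)} (hg : ∀ k, g k ∈ G) (hi : Function.Injective g) :
    zp ∈ limitSet G := ⟨g, hg, hi, zm, h⟩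

theorem IsDiscreteConvGroup.mono {G H : Subgroup (M ≃ₜ M)} (hG : IsDiscreteConvGroup G)
    (h : H ≤ G) : IsDiscreteConvGroup H := fun g hg hi => hG g (fun k => h (hg k)) hi

theorem limitSet_mono {G H : Subgroup (M ≃ₜ M)} (h : H ≤ G) : limitSet H ⊆ limitSet G :=
  fun _ ⟨g, hg, hi, zm, hc⟩ => ⟨g, fun k => h (hg k), hi, zm, hc⟩

theorem infinite_of_mem_limitSet {G : Subgroup (M ≃ₜ M)} {x : M} (hx : x ∈ limitSet G) :
    Infinite M := by
  obtain ⟨g, hg, hi, zm, hc⟩ := hx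
  exact infinite_of_injective_homeo hi

variable [CompactSpace M] [T2Space M]

theorem IsConvSeq.eventually {g : ℕ → M ≃ₜ M} {zp zm : M} (h : IsConvSeq g zp zm) {U V : Set M}
    (hU : U ∈ 𝓝 zp) (hV : V ∈ 𝓝 zm) : ∀ᶠ k in atTop, ∀ x ∉ V, g k x ∈ U :=
  isConvSeq_iff.1 h U hU V hV

theorem IsConvSeq.tendsto_of_tendsto {g : ℕ → M ≃ₜ M} {zp zm : M} (h : IsConvSeq g zp zm)
    {u : ℕ → M} {x : M} (hu : Tendsto u atTop (𝓝 x)) (hx : x ≠ zm) :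
    Tendsto (fun k => g k (u k)) atTop (𝓝 zp) := by
  intro U hU
  obtain ⟨V, W, hV, hW, hxV, hzW, hVW⟩ := t2_separation hx
  change ∀ᶠ k in atTop, g k (u k) ∈ U
  filter_upwards [h.eventually hU (hW.mem_nhds hzW),
    hu.eventually_mem (hV.mem_nhds hxV)] with k hk hk'
  exact hk _ fun hc => hVW.le_bot ⟨hk', hc⟩

theorem IsConvSeq.tendsto {g : ℕ → M ≃ₜ M} {zp zm : M} (h : IsConvSeq g zp zm)
    {x : M} (hx : x ≠ zm) : Tendsto (fun k => g k x) atTop (𝓝 zp) :=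
  h.tendsto_of_tendsto tendsto_const_nhds hx

theorem IsConvSeq.inv {g : ℕ → M ≃ₜ M} {zp zm : M} (h : IsConvSeq g zp zm) :
    IsConvSeq (fun k => (g k)⁻¹) zm zp := by
  rw [isConvSeq_iff]
  intro U hU V hV
  filter_upwards [h.eventually hV hU] with k hk x hx
  by_contra hc
  exact hx (by simpa [homeo_apply_inv_self] using hk _ hc)

theorem IsConvSeq.mul_left {g : ℕ → M ≃ₜ M} {zp zm : M} (h : IsConvSeq g zp zm) (a : M ≃ₜ M) :
    IsConvSeq (fun k => a * g k) (a zp) zm := by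
  rw [isConvSeq_iff]
  intro U hU V hV
  exact h.eventually (a.continuous.continuousAt hU) hV

theorem IsConvSeq.mul_right {g : ℕ → M ≃ₜ M} {zp zm : M} (h : IsConvSeq g zp zm)
    (a : M ≃ₜ M) : IsConvSeq (fun k => g k * a) zp (a⁻¹ zm) := by
  have := (h.inv.mul_left a⁻¹).inv
  simpa using this

theorem IsConvSeq.not_isOpen_singleton [Infinite M] {g : ℕ → M ≃ₜ M} {zp zm : M}
    (h : IsConvSeq g zp zm) : ¬ IsOpen ({zp} : Set M) := by
  intro ho
  obtain ⟨x, hx, -⟩ := exists_ne_ne zm zm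
  obtain ⟨y, hy, hyx⟩ := exists_ne_ne zm x
  have h1 := (h.tendsto hx).eventually (ho.mem_nhds rfl)
  have h2 := (h.tendsto hy).eventually (ho.mem_nhds rfl)
  obtain ⟨k, h1, h2⟩ := (h1.and h2).exists
  have h1 : g k x = zp := h1
  exact hyx ((g k).injective (h2.trans h1.symm))

theorem IsConvSeq.exists_ne_mem [Infinite M] {g : ℕ → M ≃ₜ M} {zp zm : M}
    (h : IsConvSeq g zp zm) {U : Set M} (hU : IsOpen U) (hne : U.Nonempty) :
    ∃ x ∈ U, x ≠ zm := by
  by_contra! hc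
  have : U = {zm} := hne.subset_singleton_iff.1 fun x hx => hc x hx
  exact h.inv.not_isOpen_singleton (this ▸ hU)

theorem IsConvSeq.mem_of_frequently [Infinite M] {g : ℕ → M ≃ₜ M} {zp zm : M}
    (h : IsConvSeq g zp zm) {U C : Set M} (hU : IsOpen U) (hne : U.Nonempty) (hC : IsClosed C)
    (hf : ∃ᶠ k in atTop, ∀ x ∈ U, g k x ∈ C) : zp ∈ C := by
  obtain ⟨x, hxU, hx⟩ := h.exists_ne_mem hU hne
  by_contra hzp
  obtain ⟨k, h1, h2⟩ := (hf.and_eventually ((h.tendsto hx).eventually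
    (hC.isOpen_compl.mem_nhds hzp))).exists
  exact h2 (h1 x hxU)

theorem IsConvSeq.mem_limitSet' {g : ℕ → M ≃ₜ M} {zp zm : M} (h : IsConvSeq g zp zm)
    {G : Subgroup (M ≃ₜ M)} (hg : ∀ k, g k ∈ G) (hi : Function.Injective g) :
    zm ∈ limitSet G := ⟨_, fun k => inv_mem (hg k), inv_injective.comp hi, zp, h.inv⟩

theorem IsDiscreteConvGroup.exists_seq {G : Subgroup (M ≃ₜ M)} (hG : IsDiscreteConvGroup G)
    {S : Set (M ≃ₜ M)} (hS : S.Infinite) (hSG : ∀ g ∈ S, g ∈ G) :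
    ∃ g : ℕ → M ≃ₜ M, (∀ k, g k ∈ S) ∧ Function.Injective g ∧
      ∃ zp ∈ limitSet G, ∃ zm ∈ limitSet G, IsConvSeq g zp zm := by
  let e := hS.natEmbedding S
  obtain ⟨φ, hφ, zp, zm, h⟩ := hG (fun k => (e k : M ≃ₜ M)) (fun k => hSG _ (e k).2)
    (Subtype.val_injective.comp e.injective)
  have hi : Function.Injective (fun k => (e (φ k) : M ≃ₜ M)) :=
    (Subtype.val_injective.comp e.injective).comp hφ.injective
  exact ⟨fun k => e (φ k), fun k => (e (φ k)).2, hi, zp,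
    h.mem_limitSet (fun k => hSG _ (e (φ k)).2) hi, zm,
    h.mem_limitSet' (fun k => hSG _ (e (φ k)).2) hi, h⟩

theorem IsDiscreteConvGroup.exists_subseq {G : Subgroup (M ≃ₜ M)} (hG : IsDiscreteConvGroup G)
    {g : ℕ → M ≃ₜ M} (hg : ∀ k, g k ∈ G) (hi : Function.Injective g) :
    ∃ φ : ℕ → ℕ, StrictMono φ ∧
      ∃ zp ∈ limitSet G, ∃ zm ∈ limitSet G, IsConvSeq (fun k => g (φ k)) zp zm := by
  obtain ⟨φ, hφ, zp, zm, h⟩ := hG g hg hi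
  exact ⟨φ, hφ, zp, h.mem_limitSet (fun k => hg _) (hi.comp hφ.injective), zm,
    h.mem_limitSet' (fun k => hg _) (hi.comp hφ.injective), h⟩

theorem apply_mem_limitSet {G : Subgroup (M ≃ₜ M)} {a : M ≃ₜ M} (ha : a ∈ G) {x : M}
    (hx : x ∈ limitSet G) : a x ∈ limitSet G := by
  obtain ⟨g, hg, hi, zm, hc⟩ := hx
  exact ⟨_, fun k => mul_mem ha (hg k), (mul_right_injective a).comp hi, zm, hc.mul_left a⟩

theorem apply_mem_limitSet_iff {G : Subgroup (M ≃ₜ M)} {a : M ≃ₜ M} (ha : a ∈ G) {x : M} :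
    a x ∈ limitSet G ↔ x ∈ limitSet G :=
  ⟨fun h => by simpa [homeo_inv_apply_self] using apply_mem_limitSet (inv_mem ha) h,
    apply_mem_limitSet ha⟩

theorem exists_ne_ne_of_injective {M : Type*} {ξ : Fin 3 → M} (hξ : Function.Injective ξ)
    (z : M) : ∃ i j : Fin 3, i ≠ j ∧ ξ i ≠ z ∧ ξ j ≠ z := by
  by_cases h0 : ξ 0 = z
  · exact ⟨1, 2, by decide, fun h => absurd (hξ (h.trans h0.symm)) (by decide),
      fun h => absurd (hξ (h.trans h0.symm)) (by decide)⟩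
  · by_cases h1 : ξ 1 = z
    · exact ⟨0, 2, by decide, h0, fun h => absurd (hξ (h.trans h1.symm)) (by decide)⟩
    · exact ⟨0, 1, by decide, h0, h1⟩

/-- Limit points of a discrete convergence group are those near which infinitely many group
elements send two of three fixed points. -/
theorem mem_limitSet_iff [FirstCountableTopology M] {G : Subgroup (M ≃ₜ M)}
    (hG : IsDiscreteConvGroup G) {ξ : Fin 3 → M} (hξ : Function.Injective ξ) {x : M} :
    x ∈ limitSet G ↔ ∀ U ∈ 𝓝 x,
      {g | g ∈ G ∧ ∃ i j, i ≠ j ∧ g (ξ i) ∈ U ∧ g (ξ j) ∈ U}.Infinite := by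
  have key := exists_ne_ne_of_injective hξ
  constructor
  · rintro ⟨g, hg, hi, zm, hc⟩ U hU
    obtain ⟨i, j, hij, h1, h2⟩ := key zm
    have := ((hc.tendsto h1).eventually hU).and ((hc.tendsto h2).eventually hU)
    obtain ⟨N, hN⟩ := eventually_atTop.1 this
    refine Set.infinite_of_injective_forall_mem (f := fun k => g (N + k))
      (fun a b hab => Nat.add_left_cancel (hi hab)) fun k => ?_
    exact ⟨hg _, i, j, hij, hN _ (by omega)⟩
  · intro h
    obtain ⟨U, hU⟩ := (𝓝 x).exists_antitone_basis
    obtain ⟨g, hi, hgS⟩ := exists_injective_forall_mem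
      (S := fun n => {g | g ∈ G ∧ ∃ i j, i ≠ j ∧ g (ξ i) ∈ U n ∧ g (ξ j) ∈ U n})
      (fun m n hmn g ⟨hg, i, j, hij, h1, h2⟩ =>
        ⟨hg, i, j, hij, hU.antitone hmn h1, hU.antitone hmn h2⟩)
      (fun n => h _ (hU.mem n))
    obtain ⟨φ, hφ, zp, hzp, zm, hzm, hc⟩ := hG.exists_subseq (fun k => (hgS k).1) hi
    suffices x = zp by rwa [this]
    by_contra hne
    obtain ⟨V, W, hV, hW, hxV, hzW, hVW⟩ := t2_separation hne
    obtain ⟨i, j, hij, h1, h2⟩ := key zm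
    obtain ⟨N, -, hN⟩ := hU.1.mem_iff.1 (hV.mem_nhds hxV)
    obtain ⟨k, ⟨hk1, hk2⟩, hk⟩ := ((((hc.tendsto h1).eventually (hW.mem_nhds hzW)).and
      ((hc.tendsto h2).eventually (hW.mem_nhds hzW))).and (eventually_ge_atTop N)).exists
    obtain ⟨-, a, b, hab, ha, hb⟩ := hgS (φ k)
    have hUV : U (φ k) ⊆ V := (hU.antitone (hk.trans (hφ.id_le k))).trans hN
    have hcase : ∀ a b i j : Fin 3, a ≠ b → i ≠ j → i = a ∨ i = b ∨ j = a ∨ j = b := by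
      decide
    rcases hcase a b i j hab hij with rfl | rfl | rfl | rfl
    exacts [hVW.le_bot ⟨hUV ha, hk1⟩, hVW.le_bot ⟨hUV hb, hk1⟩, hVW.le_bot ⟨hUV ha, hk2⟩,
      hVW.le_bot ⟨hUV hb, hk2⟩]

theorem exists_injective_fin_three {M : Type*} [Infinite M] :
    ∃ ξ : Fin 3 → M, Function.Injective ξ :=
  ⟨_, (Infinite.natEmbedding M).injective.comp Fin.val_injective⟩

theorem isClosed_limitSet [FirstCountableTopology M] {G : Subgroup (M ≃ₜ M)}
    (hG : IsDiscreteConvGroup G) : IsClosed (limitSet G) := by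
  rcases (limitSet G).eq_empty_or_nonempty with h | ⟨z, hz⟩
  · rw [h]; exact isClosed_empty
  have := infinite_of_mem_limitSet hz
  obtain ⟨ξ, hξ⟩ := exists_injective_fin_three (M := M)
  refine isClosed_of_closure_subset fun x hx => (mem_limitSet_iff hG hξ).2 fun U hU => ?_
  obtain ⟨V, hVU, hV, hxV⟩ := mem_nhds_iff.1 hU
  obtain ⟨y, hyV, hy⟩ := mem_closure_iff.1 hx V hV hxV
  refine ((mem_limitSet_iff hG hξ).1 hy V (hV.mem_nhds hyV)).mono ?_
  rintro g ⟨hg, i, j, hij, h1, h2⟩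
  exact ⟨hg, i, j, hij, hVU h1, hVU h2⟩

theorem IsDiscreteConvGroup.countable [TopologicalSpace.MetrizableSpace M]
    {G : Subgroup (M ≃ₜ M)} (hG : IsDiscreteConvGroup G) : (G : Set (M ≃ₜ M)).Countable := by
  by_cases hfin : (G : Set (M ≃ₜ M)).Finite
  · exact hfin.countable
  let _ := TopologicalSpace.metrizableSpaceMetric M
  obtain ⟨g, -, hgi, -⟩ := hG.exists_seq hfin fun g hg => hg
  have := infinite_of_injective_homeo hgi
  obtain ⟨ξ, hξ⟩ := exists_injective_fin_three (M := M)
  have hsub : (G : Set (M ≃ₜ M)) ⊆ ⋃ n : ℕ,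
      {g | g ∈ G ∧ ∀ i j, i ≠ j → 1 / ((n : ℝ) + 1) ≤ dist (g (ξ i)) (g (ξ j))} := by
    intro g hg
    have : ∀ i j, ∃ n : ℕ, i ≠ j → 1 / ((n : ℝ) + 1) < dist (g (ξ i)) (g (ξ j)) := by
      intro i j
      by_cases hij : i = j
      · exact ⟨0, fun h => absurd hij h⟩
      · obtain ⟨n, hn⟩ := exists_nat_one_div_lt
          (dist_pos.2 fun h => hij (hξ (g.injective h)))
        exact ⟨n, fun _ => hn⟩
    choose n hn using this
    rw [mem_iUnion]
    refine ⟨Finset.univ.sup fun i => Finset.univ.sup (n i), hg, fun i j hij =>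
      le_trans ?_ (hn i j hij).le⟩
    apply one_div_le_one_div_of_le (by positivity)
    have h1 : n i j ≤ Finset.univ.sup (n i) := Finset.le_sup (Finset.mem_univ j)
    have h2 : Finset.univ.sup (n i) ≤ Finset.univ.sup fun i => Finset.univ.sup (n i) :=
      Finset.le_sup (f := fun i => Finset.univ.sup (n i)) (Finset.mem_univ i)
    have := h1.trans h2
    gcongr
  refine (Set.countable_iUnion fun n => Set.Finite.countable ?_).mono hsub
  by_contra hinf
  obtain ⟨g, hg, hi, zp, -, zm, -, hc⟩ := hG.exists_seq hinf fun g hg => hg.1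
  obtain ⟨i, j, hij, h1, h2⟩ := exists_ne_ne_of_injective hξ zm
  have := (hc.tendsto h1).dist (hc.tendsto h2)
  rw [dist_self] at this
  obtain ⟨k, hk⟩ := (this.eventually (gt_mem_nhds (by positivity : 0 < 1 / ((n : ℝ) + 1)))).exists
  exact absurd ((hg k).2 i j hij) (not_le.2 hk)

end Basics

section Conical

variable {M : Type*} [TopologicalSpace M]

theorem exists_pow_injective_of_not_isEllipticElem [T2Space M] {h : M ≃ₜ M}
    (hh : ¬ IsEllipticElem h) : Function.Injective fun n : ℕ => h ^ n := by
  rw [injective_pow_iff_not_isOfFinOrder]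
  intro hfin
  have hf : (Set.range fun n : ℤ => toCM (h ^ n)).Finite := by
    have := (finite_zpowers.2 hfin).image toCM
    refine this.subset ?_
    rintro _ ⟨n, rfl⟩
    exact ⟨h ^ n, ⟨n, rfl⟩, rfl⟩
  apply hh
  unfold IsEllipticElem
  rw [hf.isClosed.closure_eq]
  refine ⟨hf.isCompact, ?_⟩
  rintro _ ⟨n, rfl⟩
  exact ⟨_, rfl⟩

theorem IsConicalLimitPt.mono {G H : Subgroup (M ≃ₜ M)} (hGH : G ≤ H) {p : M}
    (h : IsConicalLimitPt G p) : IsConicalLimitPt H p := by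
  obtain ⟨g, hg, h⟩ := h
  exact ⟨g, fun k => hGH (hg k), h⟩

variable [CompactSpace M] [T2Space M]

theorem IsConvSeq.unique [Infinite M] {g : ℕ → M ≃ₜ M} {a b a' b' : M} (h : IsConvSeq g a b)
    (h' : IsConvSeq g a' b') : a = a' ∧ b = b' := by
  have key : ∀ {g : ℕ → M ≃ₜ M} {a b a' b' : M}, IsConvSeq g a b → IsConvSeq g a' b' → a = a' := by
    intro g a b a' b' h h'
    obtain ⟨x, hx, hx'⟩ := exists_ne_ne b b'
    exact tendsto_nhds_unique (h.tendsto hx) (h'.tendsto hx')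
  exact ⟨key h h', key h.inv h'.inv⟩

theorem isConicalLimitPt_of_isConvSeq {G : Subgroup (M ≃ₜ M)} {f : ℕ → M ≃ₜ M} {a p c : M}
    (hf : ∀ k, f k ∈ G) (hi : Function.Injective f) (h : IsConvSeq f a p)
    (hc : Tendsto (fun k => f k p) atTop (𝓝 c)) (hca : c ≠ a) : IsConicalLimitPt G p := by
  refine ⟨f, hf, hi, fun z hz => ⟨insert (c, a) (range fun k => (f k p, f k z)),
    (hc.prodMk_nhds (h.tendsto hz)).isCompact_insert_range, ?_, fun k => Or.inr ⟨k, rfl⟩⟩⟩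
  rintro q (rfl | ⟨k, rfl⟩)
  · exact hca
  · exact fun hk => hz ((f k).injective hk).symm

theorem IsConicalLimitPt.exists_isConvSeq [FirstCountableTopology M] {G : Subgroup (M ≃ₜ M)}
    (hG : IsDiscreteConvGroup G) {p : M} (h : IsConicalLimitPt G p) :
    ∃ g : ℕ → M ≃ₜ M, (∀ k, g k ∈ G) ∧ Function.Injective g ∧ ∃ a c, a ≠ c ∧
      IsConvSeq g a p ∧ Tendsto (fun k => g k p) atTop (𝓝 c) := by
  obtain ⟨g, hg, hi, hK⟩ := h
  have := infinite_of_injective_homeo hi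
  obtain ⟨φ, hφ, a, -, b, -, hc⟩ := hG.exists_subseq hg hi
  have hb : b = p := by
    by_contra hb
    obtain ⟨z, hzp, hzb⟩ := exists_ne_ne p b
    obtain ⟨K, hKc, hKd, hKm⟩ := hK z hzp
    have ht : Tendsto (fun k => (g (φ k) p, g (φ k) z)) atTop (𝓝 (a, a)) :=
      (hc.tendsto (Ne.symm hb)).prodMk_nhds (hc.tendsto hzb)
    exact hKd _ (hKc.isClosed.mem_of_tendsto ht (Eventually.of_forall fun k => hKm _)) rfl
  subst hb
  obtain ⟨c, ψ, hψ, hcl⟩ := CompactSpace.tendsto_subseq fun k => g (φ k) b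
  refine ⟨fun k => g (φ (ψ k)), fun k => hg _, (hi.comp hφ.injective).comp hψ.injective, a, c,
    ?_, hc.comp hψ.tendsto_atTop, hcl⟩
  obtain ⟨z, hzp, -⟩ := exists_ne_ne b b
  obtain ⟨K, hKc, hKd, hKm⟩ := hK z hzp
  have ht : Tendsto (fun k => (g (φ (ψ k)) b, g (φ (ψ k)) z)) atTop (𝓝 (c, a)) :=
    hcl.prodMk_nhds ((hc.comp hψ.tendsto_atTop).tendsto hzp)
  exact (hKd _ (hKc.isClosed.mem_of_tendsto ht (Eventually.of_forall fun k => hKm _))).symm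

/-- A parabolic element has no forward invariant proper neighbourhood of its fixed point. -/
theorem forall_mem_of_image_subset {G : Subgroup (M ≃ₜ M)}
    (hG : IsDiscreteConvGroup G) {h : M ≃ₜ M} (hh : h ∈ G)
    (hi : Function.Injective fun n : ℕ => h ^ n) {p : M} (hu : ∀ x, h x = x → x = p)
    {V : Set M} (hV : V ∈ 𝓝 p) (hVV : ∀ x ∈ V, h x ∈ V) (x : M) : x ∈ V := by
  by_contra hx
  have hn : ∀ n : ℕ, (h ^ n)⁻¹ x ∉ V := by
    intro n
    induction n with
    | zero => simpa using hx
    | succ n ih =>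
      intro hc
      apply ih
      have := hVV _ hc
      rw [← homeo_mul_apply] at this
      convert this using 2
      group
  have hii : Function.Injective fun n : ℕ => (h ^ n)⁻¹ := inv_injective.comp hi
  have := infinite_of_injective_homeo hii
  obtain ⟨φ, hφ, α, -, β, -, hc⟩ := hG.exists_subseq (fun n => inv_mem (pow_mem hh n)) hii
  have h1 := hc.mul_left h
  have h2 := hc.mul_right h
  have heq : (fun k => h * (h ^ φ k)⁻¹) = fun k => (h ^ φ k)⁻¹ * h := by
    funext k
    exact ((Commute.refl h).pow_right _).inv_right
  rw [heq] at h1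
  obtain ⟨h3, h4⟩ := h1.unique h2
  have hα : α = p := hu _ h3
  have hβ : β = p := hu _ ((homeo_inv_eq_iff _).1 h4.symm).symm
  subst hα
  have hxβ : x ≠ β := by
    rintro rfl
    exact hx (hβ ▸ mem_of_mem_nhds hV)
  obtain ⟨k, hk⟩ := ((hc.tendsto hxβ).eventually hV).exists
  exact hn _ hk

theorem IsParabolicElem.not_isConicalLimitPt [FirstCountableTopology M]
    {G : Subgroup (M ≃ₜ M)} (hG : IsDiscreteConvGroup G) {h : M ≃ₜ M} (hh : h ∈ G)
    (hpar : IsParabolicElem h) {p : M} (hp : h p = p) : ¬ IsConicalLimitPt G p := by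
  intro hcon
  have hpow := exists_pow_injective_of_not_isEllipticElem hpar.1
  have hu : ∀ x, h x = x → x = p := fun x hx => hpar.2.unique hx hp
  obtain ⟨g, hg, hi, a, c, hac, hconv, hgc⟩ := hcon.exists_isConvSeq hG
  have := infinite_of_injective_homeo hi
  have key : ∀ h : M ≃ₜ M, h ∈ G → (Function.Injective fun n : ℕ => h ^ n) →
      (∀ x, h x = x → x = p) → ∀ φ : ℕ → ℕ, StrictMono φ →
      IsConvSeq (fun k => g (φ k) * h * (g (φ k))⁻¹) c a → False := by
    intro h hh hpow hu φ hφ hc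
    obtain ⟨U, W, hU, hW, haU, hcW, hUW⟩ := t2_separation hac
    obtain ⟨k, hk1, hk2⟩ := ((hc.eventually (hW.mem_nhds hcW) (hU.mem_nhds haU)).and
      ((hgc.comp hφ.tendsto_atTop).eventually (hW.mem_nhds hcW))).exists
    have hV : {x | g (φ k) x ∉ U} ∈ 𝓝 p := by
      refine Filter.mem_of_superset ((hW.preimage (g (φ k)).continuous).mem_nhds hk2) ?_
      exact fun x hx hxU => hUW.le_bot ⟨hxU, hx⟩
    have := forall_mem_of_image_subset hG hh hpow hu hV (fun x hx hxU => by
      have h1 := hk1 _ hx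
      rw [homeo_mul_apply, homeo_mul_apply, homeo_inv_apply_self] at h1
      exact hUW.le_bot ⟨hxU, h1⟩) ((g (φ k))⁻¹ a)
    exact this (by rwa [homeo_apply_inv_self])
  obtain ⟨x, hxp, -⟩ := exists_ne_ne p p
  have hhx : h x ≠ p := fun hc => hxp (h.injective (hc.trans hp.symm))
  obtain ⟨φ, hφ, ⟨h', hh'⟩ | hinj⟩ :=
    exists_strictMono_comp_injective_or_const fun k => g k * h * (g k)⁻¹
  · have hp' : ∀ k, h' (g (φ k) p) = g (φ k) p := by
      intro k
      rw [← hh' k, homeo_mul_apply, homeo_mul_apply, homeo_inv_apply_self, hp]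
    have hx' : ∀ k, h' (g (φ k) x) = g (φ k) (h x) := by
      intro k
      rw [← hh' k, homeo_mul_apply, homeo_mul_apply, homeo_inv_apply_self]
    have hc1 : h' c = c := by
      have h1 := (h'.continuous.tendsto c).comp (hgc.comp hφ.tendsto_atTop)
      refine tendsto_nhds_unique h1 ((hgc.comp hφ.tendsto_atTop).congr fun k => ?_)
      exact (hp' k).symm
    have ha1 : h' a = a := by
      have h1 := (h'.continuous.tendsto a).comp ((hconv.tendsto hxp).comp hφ.tendsto_atTop)
      refine tendsto_nhds_unique h1
        (((hconv.tendsto hhx).comp hφ.tendsto_atTop).congr fun k => ?_)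
      exact (hx' k).symm
    have hu' : ∀ y, h' y = y → y = g (φ 0) p := by
      intro y hy
      rw [← homeo_inv_eq_iff]
      apply hu
      rw [← hh' 0, homeo_mul_apply, homeo_mul_apply] at hy
      exact ((homeo_inv_eq_iff _).2 hy.symm).symm
    exact hac ((hu' a ha1).trans (hu' c hc1).symm)
  · obtain ⟨ψ, hψ, a', -, b', -, hc⟩ := hG.exists_subseq
      (g := (fun k => g k * h * (g k)⁻¹) ∘ φ)
      (fun k => mul_mem (mul_mem (hg _) hh) (inv_mem (hg _))) hinj
    have hφψ := hφ.comp hψ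
    have hc' : IsConvSeq (fun k => g (φ (ψ k)) * h * (g (φ (ψ k)))⁻¹) a' b' := hc
    have h1 : c ≠ b' → c = a' := by
      intro hne
      refine tendsto_nhds_unique (hgc.comp hφψ.tendsto_atTop)
        ((hc'.tendsto_of_tendsto (hgc.comp hφψ.tendsto_atTop) hne).congr fun k => ?_)
      simp [hp]
    have h2 : a ≠ b' → a = a' := by
      intro hne
      refine tendsto_nhds_unique ((hconv.tendsto hhx).comp hφψ.tendsto_atTop)
        ((hc'.tendsto_of_tendsto ((hconv.tendsto hxp).comp hφψ.tendsto_atTop) hne).congr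
          fun k => ?_)
      simp
    by_cases hcb : c = b'
    · have ha' := h2 (fun hab => hac (hab.trans hcb.symm))
      subst hcb ha'
      have := hc'.inv
      refine key h⁻¹ (inv_mem hh) ?_ ?_ _ hφψ ?_
      · intro m n hmn
        simp only [inv_pow, inv_inj] at hmn
        exact hpow hmn
      · intro x hx
        exact hu x ((homeo_inv_eq_iff _).1 hx).symm
      · convert this using 2
        simp [mul_assoc]
    · have hc'' := h1 hcb
      have hab : a = b' := by
        by_contra hab
        exact hac ((h2 hab).trans hc''.symm)
      subst hc'' hab
      exact key h hh hpow hu _ hφψ hc'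

theorem IsParabolicPt.not_isConicalLimitPt [FirstCountableTopology M]
    {G : Subgroup (M ≃ₜ M)} (hG : IsDiscreteConvGroup G) {p : M} (hp : IsParabolicPt G p) :
    ¬ IsConicalLimitPt G p := by
  obtain ⟨h, hh, hpar, hhp⟩ := hp
  exact hpar.not_isConicalLimitPt hG hh hhp

theorem IsConvSeq.tendsto_inv_apply_of_not_conical [FirstCountableTopology M]
    {G : Subgroup (M ≃ₜ M)} {p : M} (hp : ¬ IsConicalLimitPt G p) {f : ℕ → M ≃ₜ M} {a b : M}
    (hf : ∀ k, f k ∈ G) (hi : Function.Injective f) (h : IsConvSeq f a b) :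
    Tendsto (fun k => (f k)⁻¹ p) atTop (𝓝 b) := by
  by_cases hap : p = a
  · subst hap
    by_contra hnt
    obtain ⟨U, hU, hUf⟩ := not_tendsto_iff_exists_frequently_notMem.1 hnt
    obtain ⟨φ, hφ, hφU⟩ := extraction_of_frequently_atTop hUf
    obtain ⟨c, ψ, hψ, hc⟩ := CompactSpace.tendsto_subseq fun k => (f (φ k))⁻¹ p
    refine hp (isConicalLimitPt_of_isConvSeq (f := fun k => (f (φ (ψ k)))⁻¹)
      (fun k => inv_mem (hf _)) (inv_injective.comp (hi.comp (hφ.comp hψ).injective))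
      (h.comp (hφ.comp hψ).tendsto_atTop).inv hc ?_)
    rintro rfl
    obtain ⟨k, hk⟩ := (hc.eventually hU).exists
    exact hφU _ hk
  · exact h.inv.tendsto hap

end Conical

section Potential

theorem exists_weights {ι β : Type*} [Countable ι] (T : ℕ → ι → Set β) (hT : Monotone T)
    (hfin : ∀ s i, (T s i).Finite) :
    ∃ w : ι → ℝ, (∀ i, 0 < w i) ∧ (∀ i, w i ≤ 1) ∧ ∀ s, ∃ C : ℝ, ∀ S : Finset (ι × β),
      (∀ a ∈ S, a.2 ∈ T s a.1) → ∑ a ∈ S, w a.1 ≤ C := by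
  classical
  obtain ⟨e, he⟩ := exists_injective_nat ι
  let w : ι → ℝ := fun i => (1 / 2) ^ e i / (1 + (T (e i) i).ncard)
  have hw : ∀ i, 0 < w i := fun i => by positivity
  refine ⟨w, hw, fun i => ?_, fun s => ?_⟩
  · refine div_le_one_of_le₀ ?_ (by positivity)
    have : (1 / 2 : ℝ) ^ e i ≤ 1 := pow_le_one₀ (by norm_num) (by norm_num)
    have h0 : (0 : ℝ) ≤ (T (e i) i).ncard := by positivity
    linarith
  · let b : ι → ℝ := fun i => (T s i).ncard * w i
    have hb : Summable b := by
      refine Summable.of_norm_bounded_eventually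
        (summable_geometric_two.comp_injective he) ?_
      have hf : {i | e i < s}.Finite := (Set.finite_lt_nat s).preimage he.injOn
      filter_upwards [hf.compl_mem_cofinite] with i hi
      have hi : s ≤ e i := not_lt.1 hi
      have hle : ((T s i).ncard : ℝ) ≤ 1 + (T (e i) i).ncard := by
        have := Set.ncard_le_ncard (hT hi i) (hfin _ _)
        have : ((T s i).ncard : ℝ) ≤ (T (e i) i).ncard := by exact_mod_cast this
        linarith
      have hpos : (0 : ℝ) < 1 + (T (e i) i).ncard := by positivity
      rw [Real.norm_of_nonneg (mul_nonneg (by positivity) (hw i).le)]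
      change ((T s i).ncard : ℝ) * ((1 / 2) ^ e i / (1 + (T (e i) i).ncard)) ≤ (1 / 2) ^ e i
      rw [mul_div_assoc', div_le_iff₀ hpos, mul_comm]
      gcongr
    refine ⟨∑' i, b i, fun S hS => ?_⟩
    calc ∑ a ∈ S, w a.1 = ∑ i ∈ S.image Prod.fst, ∑ a ∈ S with a.1 = i, w a.1 :=
          (Finset.sum_fiberwise_of_maps_to (fun a ha => Finset.mem_image_of_mem _ ha) _).symm
      _ ≤ ∑ i ∈ S.image Prod.fst, b i := by
          refine Finset.sum_le_sum fun i _ => ?_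
          rw [Finset.sum_congr rfl (g := fun _ => w i)
            (fun a ha => by rw [(Finset.mem_filter.1 ha).2]), Finset.sum_const, nsmul_eq_mul]
          refine mul_le_mul_of_nonneg_right ?_ (hw i).le
          rw [Nat.cast_le, ← Set.ncard_coe_finset]
          refine Set.ncard_le_ncard_of_injOn Prod.snd ?_ ?_ (hfin _ _)
          · intro a ha
            have ha := Finset.mem_filter.1 ha
            exact ha.2 ▸ hS a ha.1
          · intro a ha b hb hab
            have ha := Finset.mem_filter.1 ha
            have hb := Finset.mem_filter.1 hb
            exact Prod.ext (ha.2.trans hb.2.symm) hab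
      _ ≤ ∑' i, b i := hb.sum_le_tsum _ fun i _ => mul_nonneg (by positivity) (hw i).le

variable {M : Type*} [TopologicalSpace M]

/-- Pairs of points that are distinct or lie off `L`. -/
def offDiagonal (L : Set M) : Set (M × M) := {q | q.1 ≠ q.2 ∨ q.1 ∉ L}

theorem isOpen_offDiagonal [T2Space M] {L : Set M} (hL : IsClosed L) :
    IsOpen (offDiagonal L) :=
  (isOpen_ne_fun continuous_fst continuous_snd).union
    (hL.isOpen_compl.preimage continuous_fst)

/-- The annuli `(A.1, A.2)` in a family having `o` on their second side and a pair of points of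
`K` on their first side. -/
def annuliMeeting (A : Set (Set M × Set M)) (o : M) (K : Set (M × M)) : Set (Set M × Set M) :=
  {P | P ∈ A ∧ (∃ q ∈ K, q.1 ∈ P.1 ∧ q.2 ∈ P.1) ∧ o ∈ P.2}

theorem exists_annuli_weights [CompactSpace M] [T2Space M] [SecondCountableTopology M]
    {ι : Type*} [Countable ι]
    (A : ι → Set (Set M × Set M)) (o : M) {L : Set M} (hL : IsClosed L)
    (hF : ∀ i, ∀ K ⊆ offDiagonal L, IsCompact K → (annuliMeeting (A i) o K).Finite) :
    ∃ w : ι → ℝ, (∀ i, 0 < w i) ∧ (∀ i, w i ≤ 1) ∧ ∀ K ⊆ offDiagonal L, IsCompact K →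
      ∃ C : ℝ, ∀ S : Finset (ι × Set M × Set M),
        (∀ a ∈ S, a.2 ∈ annuliMeeting (A a.1) o K) → ∑ a ∈ S, w a.1 ≤ C := by
  have : LocallyCompactSpace (offDiagonal L) := (isOpen_offDiagonal hL).locallyCompactSpace
  let E : CompactExhaustion (offDiagonal L) := default
  obtain ⟨w, hw0, hw1, hw⟩ := exists_weights
    (fun s i => annuliMeeting (A i) o (Subtype.val '' E s))
    (fun s t hst i P ⟨hP, ⟨q, hq, h1⟩, ho⟩ => ⟨hP, ⟨q, image_mono (E.subset hst) hq, h1⟩, ho⟩)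
    (fun s i => hF i _ (by rintro _ ⟨q, -, rfl⟩; exact q.2)
      ((E.isCompact s).image continuous_subtype_val))
  refine ⟨w, hw0, hw1, fun K hK hKc => ?_⟩
  have hKc' : IsCompact (Subtype.val ⁻¹' K : Set (offDiagonal L)) :=
    Topology.IsInducing.subtypeVal.isCompact_preimage' hKc (by simpa using hK)
  obtain ⟨s, hs⟩ := E.exists_superset_of_isCompact hKc'
  obtain ⟨C, hC⟩ := hw s
  refine ⟨C, fun S hS => hC S fun a ha => ?_⟩
  obtain ⟨hP, ⟨q, hq, h1⟩, ho⟩ := hS a ha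
  exact ⟨hP, ⟨q, ⟨⟨q, hK hq⟩, hs hq, rfl⟩, h1⟩, ho⟩

/-- A finite family of nested annuli separating `z` from `o`. -/
structure IsSeparatingChain {ι : Type*} (A : ι → Set (Set M × Set M)) (o z : M)
    (S : Finset (ι × Set M × Set M)) : Prop where
  mem : ∀ a ∈ S, a.2 ∈ A a.1
  inner : ∀ a ∈ S, z ∈ a.2.1
  outer : ∀ a ∈ S, o ∈ a.2.2
  nested : ∀ a ∈ S, ∀ b ∈ S, a ≠ b → a.2.2 ∪ b.2.1 = univ ∨ b.2.2 ∪ a.2.1 = univ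

theorem exists_chain_nhds [T1Space M] {ι : Type*} {A : ι → Set (Set M × Set M)}
    (hdisj : ∀ i, ∀ P ∈ A i, Disjoint P.1 P.2) {o π : M} (hπ : ¬ IsOpen ({π} : Set M)) {i : ι}
    (hG : ∀ V ∈ 𝓝 π, ∃ P ∈ A i, P.1 ∈ 𝓝 π ∧ o ∈ P.2 ∧ Vᶜ ⊆ P.2) (n : ℕ) :
    ∃ F : Finset (ι × Set M × Set M), IsSeparatingChain A o π F ∧ (∀ a ∈ F, a.1 = i) ∧
      (∀ a ∈ F, a.2.1 ∈ 𝓝 π) ∧ F.card = n := by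
  classical
  induction n with
  | zero => exact ⟨∅, ⟨by simp, by simp, by simp, by simp⟩, by simp, by simp, rfl⟩
  | succ n ih =>
    obtain ⟨F, hF, hi, hn, hc⟩ := ih
    have hV : (⋂ a ∈ F, a.2.1) ∈ 𝓝 π := (Filter.biInter_finset_mem F).2 hn
    obtain ⟨x, hxV, hx⟩ : ∃ x ∈ ⋂ a ∈ F, a.2.1, x ≠ π := by
      by_contra! hcon
      obtain ⟨W, hWV, hW, hπW⟩ := mem_nhds_iff.1 hV
      apply hπ
      convert hW
      exact (Subset.antisymm (fun y hy => hcon y (hWV hy)) (singleton_subset_iff.2 hπW)).symm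
    obtain ⟨P, hP, hP1, hP2, hP3⟩ := hG ((⋂ a ∈ F, a.2.1) ∩ {x}ᶜ)
      (inter_mem hV (isOpen_compl_singleton.mem_nhds (Ne.symm hx)))
    have hPF : (i, P) ∉ F := by
      intro hPF
      have h1 : x ∈ P.1 := mem_iInter₂.1 hxV _ hPF
      have h2 : x ∈ P.2 := hP3 fun h => h.2 rfl
      exact (hdisj i P hP).le_bot ⟨h1, h2⟩
    have hcov : ∀ b ∈ F, P.2 ∪ b.2.1 = univ := by
      intro b hb
      refine eq_univ_of_forall fun y => or_iff_not_imp_left.2 fun hy => ?_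
      have hy' : y ∈ (⋂ a ∈ F, a.2.1) ∩ {x}ᶜ := by
        by_contra hc
        exact hy (hP3 hc)
      exact mem_iInter₂.1 hy'.1 _ hb
    refine ⟨insert (i, P) F, ⟨?_, ?_, ?_, ?_⟩, ?_, ?_, ?_⟩
    · simpa using ⟨hP, fun a b c h => hF.mem _ h⟩
    · simpa using ⟨mem_of_mem_nhds hP1, fun a b c h => hF.inner _ h⟩
    · simpa using ⟨hP2, fun a b c h => hF.outer _ h⟩
    · intro a ha b hb hab
      rcases Finset.mem_insert.1 ha with rfl | ha
      · rcases Finset.mem_insert.1 hb with rfl | hb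
        · exact absurd rfl hab
        · exact Or.inl (hcov b hb)
      · rcases Finset.mem_insert.1 hb with rfl | hb
        · exact Or.inr (hcov a ha)
        · exact hF.nested a ha b hb hab
    · simpa using fun a b c h => hi _ h
    · simpa using ⟨hP1, fun a b c h => hn _ h⟩
    · rw [Finset.card_insert_of_notMem hPF, hc]

variable [CompactSpace M] [T2Space M] [SecondCountableTopology M]

/-- If a system of annuli sees every point of `L` and elements of `J` push points of `Z` away from
`L`, then every point of `Z` can be moved by `J` outside a fixed neighbourhood of `L`. -/
theorem exists_isOpen_forall_exists_notMem {J : Subgroup (M ≃ₜ M)} {L Z : Set M}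
    (hL : IsClosed L) (hZL : Disjoint Z L) (hZ : ∀ j ∈ J, ∀ z ∈ Z, j z ∈ Z) {o : M} (ho : o ∈ Z)
    {ι : Type*} [Countable ι] {A : ι → Set (Set M × Set M)}
    (hdisj : ∀ i, ∀ P ∈ A i, Disjoint P.1 P.2)
    (hinv : ∀ i, ∀ P ∈ A i, ∀ j ∈ J, (j ⁻¹' P.1, j ⁻¹' P.2) ∈ A i)
    (hF : ∀ i, ∀ K ⊆ offDiagonal L, IsCompact K → (annuliMeeting (A i) o K).Finite)
    (hG : ∀ π ∈ L, ∃ i, ∀ V ∈ 𝓝 π, ∃ P ∈ A i, P.1 ∈ 𝓝 π ∧ o ∈ P.2 ∧ Vᶜ ⊆ P.2)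
    (hX : ∀ π ∈ L, ∃ U D : Set M, IsClosed U ∧ IsOpen D ∧ Disjoint U (closure D) ∧ o ∉ D ∧
      ∀ V ∈ 𝓝 π, ∃ O ∈ 𝓝 π, ∀ z ∈ O ∩ Z, ∃ j ∈ J, j z ∈ U ∧ ∀ x, j x ∉ D → x ∈ V)
    (hiso : ∀ π ∈ L, ¬ IsOpen ({π} : Set M)) :
    ∃ O, IsOpen O ∧ L ⊆ O ∧ ∀ z ∈ Z, ∃ j ∈ J, j z ∉ O := by
  classical
  obtain ⟨w, hw0, hw1, hw⟩ := exists_annuli_weights A o hL hF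
  have step : ∀ π ∈ L, ∃ O, IsOpen O ∧ π ∈ O ∧ ∀ z ∈ O ∩ Z, ∃ j ∈ J, ∀ S',
      IsSeparatingChain A o (j z) S' → ∃ S, IsSeparatingChain A o z S ∧
        ∑ a ∈ S', w a.1 + 1 ≤ ∑ a ∈ S, w a.1 := by
    intro π hπ
    obtain ⟨U, D, hU, hD, hUD, hoD, hX⟩ := hX π hπ
    obtain ⟨C, hC⟩ := hw (U ×ˢ closure D) (by
      rintro ⟨y, u⟩ ⟨hy, hu⟩
      left
      rintro (rfl : y = u)
      exact hUD.le_bot ⟨hy, hu⟩) (hU.isCompact.prod isClosed_closure.isCompact)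
    obtain ⟨i, hi⟩ := hG π hπ
    obtain ⟨n, hn⟩ := exists_nat_ge ((C + 2) / w i)
    obtain ⟨F, hF, hFi, hFn, hFc⟩ := exists_chain_nhds hdisj (hiso π hπ) hi n
    have hFs : C + 2 ≤ ∑ a ∈ F, w a.1 := by
      rw [Finset.sum_congr rfl (g := fun _ => w i) (fun a ha => by rw [hFi a ha]),
        Finset.sum_const, nsmul_eq_mul, hFc]
      exact (div_le_iff₀ (hw0 i)).1 hn
    have hπo : π ≠ o := by
      rintro rfl
      exact hZL.le_bot ⟨ho, hπ⟩
    obtain ⟨O, hO, hOj⟩ := hX ((⋂ a ∈ F, a.2.1) ∩ {o}ᶜ)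
      (inter_mem ((Filter.biInter_finset_mem F).2 hFn) (isOpen_compl_singleton.mem_nhds hπo))
    obtain ⟨O', hO'O, hO', hπO'⟩ := mem_nhds_iff.1 hO
    refine ⟨O', hO', hπO', fun z hz => ?_⟩
    obtain ⟨j, hj, hjz, hjV⟩ := hOj z ⟨hO'O hz.1, hz.2⟩
    refine ⟨j, hj, fun S' hS' => ?_⟩
    have hjF : ∀ x, j x ∉ D → ∀ b ∈ F, x ∈ b.2.1 := fun x hx b hb =>
      mem_iInter₂.1 (hjV x hx).1 b hb
    have hjzD : j z ∉ D := fun h => hUD.le_bot ⟨hjz, subset_closure h⟩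
    have hjo : j o ∈ D := by
      by_contra h
      exact (hjV o h).2 rfl
    let pre : ι × Set M × Set M → ι × Set M × Set M := fun a => (a.1, j ⁻¹' a.2.1, j ⁻¹' a.2.2)
    have hpre : Function.Injective pre := by
      rintro ⟨a, b, c⟩ ⟨a', b', c'⟩ h
      simp only [pre, Prod.mk.injEq, (preimage_injective.2 j.surjective).eq_iff] at h
      simp [h]
    let S₁ := S'.filter fun a => D ⊆ a.2.2
    let S₂ := S'.filter fun a => ¬ D ⊆ a.2.2
    let S₃ := S₂.filter fun a => ∃ u ∈ D, u ∈ a.2.1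
    let S₄ := S₂.filter fun a => ¬ ∃ u ∈ D, u ∈ a.2.1
    have h12 : ∑ a ∈ S₁, w a.1 + ∑ a ∈ S₂, w a.1 = ∑ a ∈ S', w a.1 :=
      Finset.sum_filter_add_sum_filter_not _ _ _
    have h34 : ∑ a ∈ S₃, w a.1 + ∑ a ∈ S₄, w a.1 = ∑ a ∈ S₂, w a.1 :=
      Finset.sum_filter_add_sum_filter_not _ _ _
    have h3 : ∑ a ∈ S₃, w a.1 ≤ C := by
      refine hC _ fun a ha => ?_
      obtain ⟨ha, u, hu, hua⟩ := Finset.mem_filter.1 ha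
      have ha := (Finset.mem_filter.1 ha).1
      exact ⟨hS'.mem a ha, ⟨(j z, u), ⟨hjz, subset_closure hu⟩, hS'.inner a ha, hua⟩,
        hS'.outer a ha⟩
    have h4 : ∑ a ∈ S₄, w a.1 ≤ 1 := by
      have hcard : S₄.card ≤ 1 := by
        refine Finset.card_le_one.2 fun a ha b hb => ?_
        by_contra hab
        obtain ⟨ha, ha'⟩ := Finset.mem_filter.1 ha
        obtain ⟨hb, hb'⟩ := Finset.mem_filter.1 hb
        obtain ⟨ha, ha''⟩ := Finset.mem_filter.1 ha
        obtain ⟨hb, hb''⟩ := Finset.mem_filter.1 hb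
        obtain ⟨u, hu, hua⟩ := not_subset.1 ha''
        obtain ⟨v, hv, hvb⟩ := not_subset.1 hb''
        rcases hS'.nested a ha b hb hab with h | h
        · exact hb' ⟨u, hu, ((eq_univ_iff_forall.1 h) u).resolve_left hua⟩
        · exact ha' ⟨v, hv, ((eq_univ_iff_forall.1 h) v).resolve_left hvb⟩
      calc ∑ a ∈ S₄, w a.1 ≤ ∑ a ∈ S₄, (1 : ℝ) := Finset.sum_le_sum fun a _ => hw1 _
        _ = S₄.card := by simp
        _ ≤ 1 := by exact_mod_cast hcard
    have hdis : Disjoint (S₁.image pre) F := by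
      rw [Finset.disjoint_left]
      intro b hb hbF
      obtain ⟨a, ha, rfl⟩ := Finset.mem_image.1 hb
      have ha := (Finset.mem_filter.1 ha).1
      have h1 : j⁻¹ o ∈ (pre a).2.1 :=
        hjF _ (by rwa [homeo_apply_inv_self]) _ hbF
      have h2 : j⁻¹ o ∈ (pre a).2.2 := by
        change j (j⁻¹ o) ∈ a.2.2
        rw [homeo_apply_inv_self]
        exact hS'.outer a ha
      exact (hdisj _ _ (hF.mem _ hbF)).le_bot ⟨h1, h2⟩
    have hcov : ∀ a ∈ S₁, ∀ b ∈ F, (pre a).2.2 ∪ b.2.1 = univ := by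
      intro a ha b hb
      refine eq_univ_of_forall fun y => ?_
      by_cases hy : j y ∈ D
      · exact Or.inl ((Finset.mem_filter.1 ha).2 hy)
      · exact Or.inr (hjF y hy b hb)
    refine ⟨S₁.image pre ∪ F, ⟨?_, ?_, ?_, ?_⟩, ?_⟩
    · intro a ha
      rcases Finset.mem_union.1 ha with ha | ha
      · obtain ⟨a, ha', rfl⟩ := Finset.mem_image.1 ha
        exact hinv _ _ (hS'.mem a (Finset.mem_filter.1 ha').1) j hj
      · exact hF.mem a ha
    · intro a ha
      rcases Finset.mem_union.1 ha with ha | ha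
      · obtain ⟨a, ha', rfl⟩ := Finset.mem_image.1 ha
        exact hS'.inner a (Finset.mem_filter.1 ha').1
      · exact hjF z hjzD a ha
    · intro a ha
      rcases Finset.mem_union.1 ha with ha | ha
      · obtain ⟨a, ha', rfl⟩ := Finset.mem_image.1 ha
        exact (Finset.mem_filter.1 ha').2 hjo
      · exact hF.outer a ha
    · intro a ha b hb hab
      rcases Finset.mem_union.1 ha with ha | ha
      · obtain ⟨a, ha', rfl⟩ := Finset.mem_image.1 ha
        rcases Finset.mem_union.1 hb with hb | hb
        · obtain ⟨b, hb', rfl⟩ := Finset.mem_image.1 hb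
          rcases hS'.nested a (Finset.mem_filter.1 ha').1 b (Finset.mem_filter.1 hb').1
            (fun h => hab (by rw [h])) with h | h
          · left
            change j ⁻¹' (a.2.2 ∪ b.2.1) = univ
            rw [h, preimage_univ]
          · right
            change j ⁻¹' (b.2.2 ∪ a.2.1) = univ
            rw [h, preimage_univ]
        · exact Or.inl (hcov a ha' b hb)
      · rcases Finset.mem_union.1 hb with hb | hb
        · obtain ⟨b, hb', rfl⟩ := Finset.mem_image.1 hb
          exact Or.inr (hcov b hb' a ha)
        · exact hF.nested a ha b hb hab
    · rw [Finset.sum_union hdis, Finset.sum_image hpre.injOn]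
      change _ ≤ ∑ a ∈ S₁, w a.1 + _
      linarith
  choose! O hO hπO hstep using step
  refine ⟨⋃ π ∈ L, O π, isOpen_biUnion fun π hπ => hO π hπ,
    fun π hπ => mem_biUnion hπ (hπO π hπ), fun z hz => ?_⟩
  by_contra! hcon
  have hgrow : ∀ n : ℕ, ∀ j ∈ J, ∃ S, IsSeparatingChain A o (j z) S ∧ (n : ℝ) ≤ ∑ a ∈ S, w a.1 := by
    intro n
    induction n with
    | zero => exact fun j hj => ⟨∅, ⟨by simp, by simp, by simp, by simp⟩, by simp⟩
    | succ n ih =>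
      intro j hj
      obtain ⟨π, hπ, hjπ⟩ := mem_iUnion₂.1 (hcon j hj)
      obtain ⟨j', hj', h⟩ := hstep π hπ (j z) ⟨hjπ, hZ j hj z hz⟩
      obtain ⟨S', hS', hn⟩ := ih (j' * j) (mul_mem hj' hj)
      obtain ⟨S, hS, hle⟩ := h S' hS'
      refine ⟨S, hS, ?_⟩
      push_cast
      linarith
  obtain ⟨C, hC⟩ := hw {(z, z)} (by
    rintro _ rfl
    right
    exact fun h => hZL.le_bot ⟨hz, h⟩) isCompact_singleton
  obtain ⟨n, hn⟩ := exists_nat_gt C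
  obtain ⟨S, hS, hle⟩ := hgrow n 1 (one_mem _)
  have := hC S fun a ha => ⟨hS.mem a ha, ⟨(z, z), rfl, hS.inner a ha, hS.inner a ha⟩,
    hS.outer a ha⟩
  linarith

end Potential

section Annuli

variable {M : Type*} [TopologicalSpace M] [CompactSpace M] [T2Space M]

/-- In a discrete convergence group, the stabilizer of a point that is not conical acts properly
on the complement of the point. -/
theorem finite_stabilizer_inv_apply_notMem {J : Subgroup (M ≃ₜ M)} (hJ : IsDiscreteConvGroup J)
    {b : M} (hb : ¬ IsConicalLimitPt J b) {C V : Set M} (hC : IsClosed C) (hbC : b ∉ C)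
    (hV : V ∈ 𝓝 b) : {q | q ∈ J ∧ q b = b ∧ ∃ x ∈ C, q⁻¹ x ∉ V}.Finite := by
  by_contra hinf
  obtain ⟨q, hq, hi, α, -, β, -, hc⟩ := hJ.exists_seq hinf fun q hq => hq.1
  have hqb : Tendsto (fun k => q k b) atTop (𝓝 b) :=
    tendsto_const_nhds.congr fun k => (hq k).2.1.symm
  have hqb' : Tendsto (fun k => (q k)⁻¹ b) atTop (𝓝 b) :=
    tendsto_const_nhds.congr fun k => ((homeo_inv_eq_iff _).2 (hq k).2.1.symm).symm
  have hβ : β = b := by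
    by_contra hβ
    have hα : α = b := tendsto_nhds_unique (hc.tendsto (Ne.symm hβ)) hqb
    subst hα
    exact hb (isConicalLimitPt_of_isConvSeq (fun k => inv_mem (hq k).1) (inv_injective.comp hi)
      hc.inv hqb' (Ne.symm hβ))
  subst hβ
  have hα : α = β := by
    by_contra hα
    exact hb (isConicalLimitPt_of_isConvSeq (fun k => (hq k).1) hi hc hqb (Ne.symm hα))
  subst hα
  obtain ⟨k, hk⟩ := (hc.inv.eventually hV (hC.isOpen_compl.mem_nhds hbC)).exists
  obtain ⟨x, hx, hxV⟩ := (hq k).2.2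
  exact hxV (hk x fun h => h hx)

variable [FirstCountableTopology M]

theorem finite_apply_mem_of_disjoint {J : Subgroup (M ≃ₜ M)} (hJ : IsDiscreteConvGroup J)
    {o : M} (ho : o ∉ limitSet J) {K : Set (M × M)} (hK : IsCompact K)
    (hKL : K ⊆ offDiagonal (limitSet J)) {U W : Set M} (hU : IsClosed U) (hW : IsClosed W)
    (hUW : Disjoint U W) :
    {γ | γ ∈ J ∧ (∃ q ∈ K, γ q.1 ∈ U ∧ γ q.2 ∈ U) ∧ γ o ∈ W}.Finite := by
  by_contra hinf
  obtain ⟨γ, hγ, hi, a, ha, b, hb, hc⟩ := hJ.exists_seq hinf fun q hq => hq.1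
  have hob : o ≠ b := by
    rintro rfl
    exact ho hb
  have haW : a ∈ W := hW.mem_of_tendsto (hc.tendsto hob)
    (Eventually.of_forall fun k => (hγ k).2.2)
  choose q hqK hq1 hq2 using fun k => (hγ k).2.1
  obtain ⟨⟨y, u⟩, hyu, φ, hφ, hlim⟩ := hK.tendsto_subseq hqK
  have hc' := hc.comp hφ.tendsto_atTop
  have hy : Tendsto (fun k => (q (φ k)).1) atTop (𝓝 y) := (continuous_fst.tendsto _).comp hlim
  have hu : Tendsto (fun k => (q (φ k)).2) atTop (𝓝 u) := (continuous_snd.tendsto _).comp hlim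
  refine hUW.le_bot ⟨?_, haW⟩
  by_cases hyb : y = b
  · have hub : u ≠ b := by
      rintro rfl
      rcases hKL hyu with h | h
      · exact h hyb
      · exact h (hyb ▸ hb)
    exact hU.mem_of_tendsto (hc'.tendsto_of_tendsto hu hub) (Eventually.of_forall fun k => hq2 _)
  · exact hU.mem_of_tendsto (hc'.tendsto_of_tendsto hy hyb) (Eventually.of_forall fun k => hq1 _)

/-- The translates of a fixed annulus. -/
def translatedAnnuli (J : Subgroup (M ≃ₜ M)) (U W : Set M) : Set (Set M × Set M) :=
  {P | Disjoint U W ∧ ∃ γ ∈ J, P = (γ ⁻¹' U, γ ⁻¹' W)}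

theorem finite_annuliMeeting_translatedAnnuli {J : Subgroup (M ≃ₜ M)}
    (hJ : IsDiscreteConvGroup J) {o : M} (ho : o ∉ limitSet J) {K : Set (M × M)}
    (hK : IsCompact K) (hKL : K ⊆ offDiagonal (limitSet J)) {U W : Set M} (hU : IsClosed U)
    (hW : IsClosed W) : (annuliMeeting (translatedAnnuli J U W) o K).Finite := by
  by_cases hUW : Disjoint U W
  · refine ((finite_apply_mem_of_disjoint hJ ho hK hKL hU hW hUW).image
      fun γ : M ≃ₜ M => ((γ ⁻¹' U, γ ⁻¹' W) : Set M × Set M)).subset ?_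
    rintro _ ⟨⟨-, γ, hγ, rfl⟩, hq, hoW⟩
    exact ⟨γ, ⟨hγ, hq, hoW⟩, rfl⟩
  · convert Set.finite_empty
    exact eq_empty_of_forall_notMem fun P hP => hUW hP.1.1

/-- The translates of the annuli between consecutive terms of a sequence of neighbourhoods. -/
def nestedAnnuli (J : Subgroup (M ≃ₜ M)) (V : ℕ → Set M) : Set (Set M × Set M) :=
  {P | ∃ γ ∈ J, ∃ i, P = (γ ⁻¹' V (i + 1), γ ⁻¹' (V i)ᶜ)}

theorem exists_nested_nhds {J : Subgroup (M ≃ₜ M)} (hJ : IsDiscreteConvGroup J)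
    {b : M} (hb : ¬ IsConicalLimitPt J b) {K : Set M} (hK : IsClosed K) (hbK : b ∉ K) :
    ∃ N V : ℕ → Set M, (𝓝 b).HasAntitoneBasis N ∧ Disjoint (closure (N 0)) K ∧
      (∀ i, V i ∈ 𝓝 b) ∧ (∀ i, V (i + 1) ⊆ V i) ∧ (∀ i, V (i + 1) ⊆ N i) ∧
      ∀ i, ∀ q ∈ J, q b = b → (∃ x ∈ K, q⁻¹ x ∉ V i) → ∀ x ∈ V (i + 1), q x ∈ N i := by
  obtain ⟨N, hN⟩ := (𝓝 b).exists_antitone_basis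
  obtain ⟨C, hC, hCc, hCK⟩ := exists_mem_nhds_isClosed_subset (hK.isOpen_compl.mem_nhds hbK)
  obtain ⟨n, hn⟩ := hN.mem_iff.1 hC
  let N' : ℕ → Set M := fun i => N (i + n)
  have hN' : (𝓝 b).HasAntitoneBasis N' := by
    refine ⟨⟨fun t => ?_⟩, fun i j hij => hN.antitone (by omega)⟩
    constructor
    · intro ht
      obtain ⟨i, hi⟩ := hN.mem_iff.1 ht
      exact ⟨i, trivial, (hN.antitone (by omega)).trans hi⟩
    · rintro ⟨i, -, hi⟩
      exact mem_of_superset (hN.mem _) hi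
  have hstep : ∀ (i : ℕ) (V : {V : Set M // V ∈ 𝓝 b}), ∃ V' : {V : Set M // V ∈ 𝓝 b},
      V'.1 ⊆ V.1 ∧ V'.1 ⊆ N' i ∧
      ∀ q ∈ J, q b = b → (∃ x ∈ K, q⁻¹ x ∉ V.1) → ∀ x ∈ V'.1, q x ∈ N' i := by
    rintro i ⟨V, hV⟩
    have hfin := finite_stabilizer_inv_apply_notMem hJ hb hK hbK hV
    refine ⟨⟨V ∩ N' i ∩ ⋂ q ∈ {q | q ∈ J ∧ q b = b ∧ ∃ x ∈ K, q⁻¹ x ∉ V}, q ⁻¹' N' i, ?_⟩,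
      fun x hx => hx.1.1, fun x hx => hx.1.2, fun q hq hqb hqx x hx => ?_⟩
    · refine inter_mem (inter_mem hV (hN'.mem i)) ((Filter.biInter_mem hfin).2 fun q hq => ?_)
      refine q.continuous.continuousAt ?_
      rw [hq.2.1]
      exact hN'.mem i
    · exact mem_iInter₂.1 hx.2 q ⟨hq, hqb, hqx⟩
  choose f hf1 hf2 hf3 using hstep
  let V : ℕ → {V : Set M // V ∈ 𝓝 b} := fun n => Nat.rec ⟨univ, univ_mem⟩ f n
  refine ⟨N', fun i => (V i).1, hN', ?_, fun i => (V i).2, fun i => hf1 i (V i),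
    fun i => hf2 i (V i), fun i => hf3 i (V i)⟩
  refine disjoint_left.2 fun x hx hxK => hCK (closure_minimal ?_ hCc hx) hxK
  simpa [N'] using hn

theorem finite_annuliMeeting_nestedAnnuli {J : Subgroup (M ≃ₜ M)}
    (hJ : IsDiscreteConvGroup J) {Z : Set M} (hZ : ∀ j ∈ J, ∀ z ∈ Z, j z ∈ Z) {o : M}
    (hoZ : o ∈ Z) (ho : o ∉ limitSet J) {b : M} (hbL : b ∈ limitSet J)
    (hb : ¬ IsConicalLimitPt J b) {K : Set M} (hK : IsClosed K)
    (hbK : b ∉ K) (hKZ : ∀ z ∈ Z, ∃ q ∈ J, q b = b ∧ q z ∈ K) {N V : ℕ → Set M}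
    (hN : (𝓝 b).HasAntitoneBasis N) (hNK : Disjoint (closure (N 0)) K)
    (hV : ∀ i, V i ∈ 𝓝 b)
    (hVN : ∀ i, ∀ q ∈ J, q b = b → (∃ x ∈ K, q⁻¹ x ∉ V i) → ∀ x ∈ V (i + 1), q x ∈ N i)
    {E : Set (M × M)} (hE : IsCompact E) (hEL : E ⊆ offDiagonal (limitSet J)) :
    (annuliMeeting (nestedAnnuli J V) o E).Finite := by
  have h1 := finite_apply_mem_of_disjoint hJ ho hE hEL isClosed_closure hK hNK
  have h2 : ∀ γ ∈ J, {i | ∃ q ∈ E, γ q.1 ∈ N i ∧ γ q.2 ∈ N i}.Finite := by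
    intro γ hγ
    have hcpt : IsCompact (Prod.map γ γ '' E) :=
      hE.image (γ.continuous.prodMap γ.continuous)
    have hbb : (b, b) ∉ Prod.map γ γ '' E := by
      rintro ⟨⟨y, u⟩, hyu, h⟩
      simp only [Prod.map_apply, Prod.mk.injEq] at h
      have hy : y = u := γ.injective (h.1.trans h.2.symm)
      rcases hEL hyu with h' | h'
      · exact h' hy
      · exact h' ((apply_mem_limitSet_iff hγ).1 (h.1.symm ▸ hbL))
    obtain ⟨u, hu, v, hv, huv⟩ := mem_nhds_prod_iff.1 (hcpt.isClosed.isOpen_compl.mem_nhds hbb)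
    obtain ⟨n, hn⟩ := hN.mem_iff.1 (inter_mem hu hv)
    refine (Set.finite_lt_nat n).subset ?_
    rintro i ⟨q, hq, hq1, hq2⟩
    by_contra hi
    have hi : n ≤ i := not_lt.1 hi
    exact huv (mk_mem_prod (hn (hN.antitone hi hq1)).1 (hn (hN.antitone hi hq2)).2)
      ⟨q, hq, rfl⟩
  have h3 : {x : (M ≃ₜ M) × ℕ | x.1 ∈ J ∧ x.1 o ∈ K ∧
      ∃ q ∈ E, x.1 q.1 ∈ N x.2 ∧ x.1 q.2 ∈ N x.2}.Finite := by
    refine (h1.biUnion fun γ hγ => (h2 γ hγ.1).image fun i => (γ, i)).subset ?_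
    rintro ⟨γ, i⟩ ⟨hγ, ho, q, hq, hq1, hq2⟩
    exact mem_biUnion (x := γ) ⟨hγ, ⟨q, hq, subset_closure (hN.antitone (Nat.zero_le i) hq1),
      subset_closure (hN.antitone (Nat.zero_le i) hq2)⟩, ho⟩ ⟨i, ⟨q, hq, hq1, hq2⟩, rfl⟩
  refine (h3.biUnion fun x _ => (finite_stabilizer_inv_apply_notMem hJ hb hK hbK (hV x.2)).image
    fun q => (((q⁻¹ * x.1 : M ≃ₜ M) ⁻¹' V (x.2 + 1), (q⁻¹ * x.1 : M ≃ₜ M) ⁻¹' (V x.2)ᶜ) :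
      Set M × Set M)).subset ?_
  rintro _ ⟨⟨γ, hγ, i, rfl⟩, ⟨e, he, he1, he2⟩, hoV⟩
  obtain ⟨q, hq, hqb, hqK⟩ := hKZ (γ o) (hZ γ hγ o hoZ)
  have hqi : ∃ x ∈ K, q⁻¹ x ∉ V i := ⟨_, hqK, by rw [homeo_inv_apply_self]; exact hoV⟩
  refine mem_biUnion (x := (q * γ, i)) ⟨mul_mem hq hγ, hqK, e, he, hVN i q hq hqb hqi _ he1,
    hVN i q hq hqb hqi _ he2⟩ ⟨q, ⟨hq, hqb, hqi⟩, ?_⟩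
  simp only [inv_mul_cancel_left]

end Annuli

section Orbits

variable {M : Type*} [TopologicalSpace M] [CompactSpace M] [TopologicalSpace.MetrizableSpace M]

theorem countable_setOf_isParabolicPt {J : Subgroup (M ≃ₜ M)} (hJ : IsDiscreteConvGroup J) :
    {b | IsParabolicPt J b}.Countable := by
  have : Countable J := hJ.countable.to_subtype
  choose h hh hpar hfix using fun b : {b | IsParabolicPt J b} => b.2
  rw [← Set.countable_coe_iff]
  refine Function.Injective.countable (f := fun b => (⟨h b, hh b⟩ : J)) fun b c hbc => ?_
  have hbc : h b = h c := congrArg Subtype.val hbc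
  exact Subtype.ext ((hpar b).2.unique (hfix b) (by rw [hbc]; exact hfix c))

/-- A `J`-invariant set disjoint from `Λ(J)`, on which the stabilizers of the non-conical limit
points of `J` act cocompactly away from these points, has representatives of its `J`-orbits
outside a fixed neighbourhood of `Λ(J)`. -/
theorem exists_isOpen_limitSet_subset_forall_exists_notMem {J : Subgroup (M ≃ₜ M)}
    (hJ : IsDiscreteConvGroup J) {Z : Set M} (hZL : Disjoint Z (limitSet J))
    (hZ : ∀ j ∈ J, ∀ z ∈ Z, j z ∈ Z)
    (h : ∀ b ∈ limitSet J, IsConicalLimitPt J b ∨ (¬ IsConicalLimitPt J b ∧ IsParabolicPt J b ∧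
      ∃ K, IsClosed K ∧ b ∉ K ∧ ∀ z ∈ Z, ∃ q ∈ J, q b = b ∧ q z ∈ K)) :
    ∃ O, IsOpen O ∧ limitSet J ⊆ O ∧ ∀ z ∈ Z, ∃ j ∈ J, j z ∉ O := by
  rcases Z.eq_empty_or_nonempty with rfl | ⟨o, hoZ⟩
  · exact ⟨univ, isOpen_univ, subset_univ _, by simp⟩
  let _ := TopologicalSpace.metrizableSpaceMetric M
  have hsc : SecondCountableTopology M := inferInstance
  have ho : o ∉ limitSet J := fun hc => hZL.le_bot ⟨hoZ, hc⟩
  let B := {b | b ∈ limitSet J ∧ ¬ IsConicalLimitPt J b ∧ IsParabolicPt J b}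
  have hB : Countable B :=
    ((countable_setOf_isParabolicPt hJ).mono fun b hb => hb.2.2).to_subtype
  have hcb : Countable (TopologicalSpace.countableBasis M) :=
    (TopologicalSpace.countable_countableBasis M).to_subtype
  have hK : ∀ b : B, ∃ K, IsClosed K ∧ b.1 ∉ K ∧ ∀ z ∈ Z, ∃ q ∈ J, q b = b ∧ q z ∈ K := by
    rintro ⟨b, hb⟩
    rcases h b hb.1 with hc | hc
    · exact absurd hc hb.2.1
    · exact hc.2.2
  choose K hKc hbK hKZ using hK
  choose N V hN hNK hV hVV hVN hVq using
    fun b : B => exists_nested_nhds hJ b.2.2.1 (hKc b) (hbK b)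
  let A : ((TopologicalSpace.countableBasis M) × (TopologicalSpace.countableBasis M)) ⊕ B →
      Set (Set M × Set M) :=
    Sum.elim (fun i => translatedAnnuli J (closure i.1.1) (closure i.2.1))
      (fun b => nestedAnnuli J (V b))
  have hcon : ∀ π ∈ limitSet J, IsConicalLimitPt J π → ∃ g : ℕ → M ≃ₜ M, (∀ k, g k ∈ J) ∧
      ∃ U ∈ TopologicalSpace.countableBasis M, ∃ W ∈ TopologicalSpace.countableBasis M,
        Disjoint (closure U) (closure W) ∧ o ∉ W ∧ (∀ᶠ k in atTop, g k π ∈ U) ∧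
        (∀ᶠ k in atTop, g k o ∈ W) ∧ ∀ V ∈ 𝓝 π, ∀ᶠ k in atTop, ∀ x ∉ V, g k x ∈ W := by
    intro π hπ hconical
    obtain ⟨g, hg, hi, a, c, hac, hconv, hgc⟩ := hconical.exists_isConvSeq hJ
    obtain ⟨W₀, haW, hW, U₀, hcU, hU, hd⟩ := exists_open_nhds_disjoint_closure hac
    have hao : a ≠ o := by
      rintro rfl
      exact ho (hconv.mem_limitSet hg hi)
    have hoπ : o ≠ π := by
      rintro rfl
      exact ho hπ
    have hb := TopologicalSpace.isBasis_countableBasis M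
    obtain ⟨U, hUb, hcU, hUU⟩ := hb.exists_subset_of_mem_open hcU hU
    obtain ⟨W, hWb, haW, hWW⟩ := hb.exists_subset_of_mem_open
      (⟨haW, hao⟩ : a ∈ W₀ ∩ {o}ᶜ) (hW.inter isOpen_compl_singleton)
    refine ⟨g, hg, U, hUb, W, hWb, hd.symm.mono (closure_mono hUU)
      (closure_mono (hWW.trans inter_subset_left)), fun h => (hWW h).2 rfl, ?_, ?_, ?_⟩
    · exact hgc.eventually_mem ((hb.isOpen hUb).mem_nhds hcU)
    · exact (hconv.tendsto hoπ).eventually_mem ((hb.isOpen hWb).mem_nhds haW)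
    · exact fun V hV => hconv.eventually ((hb.isOpen hWb).mem_nhds haW) hV
  refine exists_isOpen_forall_exists_notMem (A := A) (isClosed_limitSet hJ) hZL hZ hoZ
    ?_ ?_ ?_ ?_ ?_ ?_
  · rintro (i | b) P hP
    · obtain ⟨hd, γ, hγ, rfl⟩ := hP
      exact hd.preimage γ
    · obtain ⟨γ, hγ, i, rfl⟩ := hP
      exact (disjoint_compl_right.mono_left (hVV b i)).preimage γ
  · rintro (i | b) P hP j hj
    · obtain ⟨hd, γ, hγ, rfl⟩ := hP
      exact ⟨hd, γ * j, mul_mem hγ hj, rfl⟩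
    · obtain ⟨γ, hγ, i, rfl⟩ := hP
      exact ⟨γ * j, mul_mem hγ hj, i, rfl⟩
  · rintro (i | b) E hEL hE
    · exact finite_annuliMeeting_translatedAnnuli hJ ho hE hEL isClosed_closure isClosed_closure
    · exact finite_annuliMeeting_nestedAnnuli hJ hZ hoZ ho b.2.1 b.2.2.1 (hKc b) (hbK b) (hKZ b)
        (hN b) (hNK b) (hV b) (hVq b) hE hEL
  · intro π hπ
    rcases h π hπ with hc | ⟨hnc, hpar, -⟩
    · obtain ⟨g, hg, U, hUb, W, hWb, hd, -, h1, h2, h3⟩ := hcon π hπ hc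
      refine ⟨Sum.inl (⟨U, hUb⟩, ⟨W, hWb⟩), fun V hV => ?_⟩
      obtain ⟨k, ⟨hk1, hk2⟩, hk3⟩ := ((h1.and h2).and (h3 V hV)).exists
      refine ⟨_, ⟨hd, g k, hg k, rfl⟩, ?_, subset_closure hk2, fun x hx =>
        subset_closure (hk3 x hx)⟩
      exact mem_of_superset ((((TopologicalSpace.isBasis_countableBasis M).isOpen hUb).preimage
        (g k).continuous).mem_nhds hk1) (preimage_mono subset_closure)
    · refine ⟨Sum.inr ⟨π, hπ, hnc, hpar⟩, fun V' hV' => ?_⟩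
      have hπo : π ≠ o := by
        rintro rfl
        exact ho hπ
      obtain ⟨i, hi⟩ := (hN ⟨π, hπ, hnc, hpar⟩).mem_iff.1
        (inter_mem hV' (isOpen_compl_singleton.mem_nhds hπo))
      refine ⟨_, ⟨1, one_mem _, i + 1, rfl⟩, hV ⟨π, hπ, hnc, hpar⟩ _, fun hoV => ?_,
        fun x hx hxV => ?_⟩
      · exact (hi (hVN _ _ hoV)).2 rfl
      · exact hx (hi (hVN _ _ hxV)).1
  · intro π hπ
    rcases h π hπ with hc | ⟨hnc, hpar, -⟩
    · obtain ⟨g, hg, U, hUb, W, hWb, hd, hoW, h1, h2, h3⟩ := hcon π hπ hc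
      have hb := TopologicalSpace.isBasis_countableBasis M
      refine ⟨closure U, W, isClosed_closure, hb.isOpen hWb, hd, hoW, fun V hV => ?_⟩
      obtain ⟨k, hk1, hk3⟩ := (h1.and (h3 V hV)).exists
      refine ⟨g k ⁻¹' U, ((hb.isOpen hUb).preimage (g k).continuous).mem_nhds hk1,
        fun z hz => ⟨g k, hg k, subset_closure hz.1, fun x hx => ?_⟩⟩
      by_contra hxV
      exact hx (hk3 x hxV)
    · let b : B := ⟨π, hπ, hnc, hpar⟩
      have hπo : π ≠ o := by
        rintro rfl
        exact ho hπ
      obtain ⟨C, hC, hCc, hCK⟩ := exists_mem_nhds_isClosed_subset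
        (inter_mem ((hKc b).isOpen_compl.mem_nhds (hbK b))
          (isOpen_compl_singleton.mem_nhds hπo))
      refine ⟨K b, interior C, hKc b, isOpen_interior, ?_, fun hoC => (hCK (interior_subset hoC)).2
        rfl, fun V' hV' => ?_⟩
      · refine disjoint_left.2 fun x hxK hx => ?_
        exact (hCK (closure_minimal interior_subset hCc hx)).1 hxK
      · have hfin := finite_stabilizer_inv_apply_notMem hJ hnc isOpen_interior.isClosed_compl
          (C := (interior C)ᶜ) (fun h => h (mem_interior_iff_mem_nhds.2 hC)) hV'
        refine ⟨⋂ q ∈ {q | q ∈ J ∧ q π = π ∧ ∃ x ∈ (interior C)ᶜ, q⁻¹ x ∉ V'}, (q ⁻¹' K b)ᶜ,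
          (Filter.biInter_mem hfin).2 fun q hq => ?_, fun z hz => ?_⟩
        · refine (((hKc b).preimage q.continuous).isOpen_compl).mem_nhds ?_
          rw [mem_compl_iff, mem_preimage, hq.2.1]
          exact hbK b
        · obtain ⟨q, hq, hqb, hqK⟩ := hKZ b z hz.2
          refine ⟨q, hq, hqK, fun x hx => ?_⟩
          by_contra hxV
          refine mem_iInter₂.1 hz.1 q ⟨hq, hqb, q x, hx, ?_⟩ hqK
          rwa [homeo_inv_apply_self]
  · rintro π ⟨g, hg, hi, zm, hc⟩
    have := infinite_of_injective_homeo hi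
    exact hc.not_isOpen_singleton

end Orbits

section Amalgam

variable {M : Type*} [TopologicalSpace M]

/-- Two discrete convergence groups `H true`, `H false` in ping-pong position with respect to a
common proper subgroup `J`, for closed sets each of which is disjoint from the interior of the
other one. -/
structure AmalgamPosition (H : Bool → Subgroup (M ≃ₜ M)) (J : Subgroup (M ≃ₜ M))
    (B : Bool → Set M) : Prop where
  discrete : ∀ i, IsDiscreteConvGroup (H i)
  le : ∀ i, J ≤ H i
  exists_notMem : ∀ i, ∃ g ∈ H i, g ∉ J
  isClosed : ∀ i, IsClosed (B i)
  nonempty : ∀ i, (interior (B i)).Nonempty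
  disjoint : ∀ i, Disjoint (B i) (interior (B !i))
  inv : ∀ i, ∀ j ∈ J, ∀ x ∈ B i, j x ∈ B i
  pp : ∀ i, ∀ g ∈ H i, g ∉ J → ∀ x ∈ B i, g x ∈ interior (B !i)
  lim : ∀ i, ∀ x ∈ limitSet (H i), x ∉ limitSet J → x ∈ interior (B !i)

/-- Alternating words with first letter in `H i ∖ J` and last letter in `H k ∖ J`. -/
inductive AlternatingWord (H : Bool → Subgroup (M ≃ₜ M)) (J : Subgroup (M ≃ₜ M)) :
    Bool → Bool → (M ≃ₜ M) → Prop
  | single {i : Bool} {g : M ≃ₜ M} (hg : g ∈ H i) (hgJ : g ∉ J) : AlternatingWord H J i i g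
  | cons {i k : Bool} {g u : M ≃ₜ M} (hg : g ∈ H i) (hgJ : g ∉ J)
      (hu : AlternatingWord H J (!i) k u) : AlternatingWord H J i k (g * u)

namespace AlternatingWord

variable {H : Bool → Subgroup (M ≃ₜ M)} {J : Subgroup (M ≃ₜ M)}

theorem snoc {i k : Bool} {u g : M ≃ₜ M} (hu : AlternatingWord H J i k u) (hg : g ∈ H !k)
    (hgJ : g ∉ J) : AlternatingWord H J i (!k) (u * g) := by
  induction hu with
  | @single i h hh hhJ => exact cons hh hhJ (single hg hgJ)
  | cons hh hhJ _ ih =>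
    rw [mul_assoc]
    exact cons hh hhJ (ih hg)

theorem inv {i k : Bool} {u : M ≃ₜ M} (hu : AlternatingWord H J i k u) :
    AlternatingWord H J k i u⁻¹ := by
  induction hu with
  | single hh hhJ => exact single (inv_mem hh) (by rwa [inv_mem_iff])
  | @cons i k g u hh hhJ _ ih =>
    rw [mul_inv_rev]
    have := ih.snoc (g := g⁻¹) (by rw [Bool.not_not]; exact inv_mem hh) (by rwa [inv_mem_iff])
    rwa [Bool.not_not] at this

theorem mul_left (hJ : ∀ i, J ≤ H i) {i k : Bool} {u j : M ≃ₜ M}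
    (hu : AlternatingWord H J i k u) (hj : j ∈ J) : AlternatingWord H J i k (j * u) := by
  cases hu with
  | single hh hhJ => exact single (mul_mem (hJ _ hj) hh) (by rwa [J.mul_mem_cancel_left hj])
  | cons hh hhJ hu =>
    rw [← mul_assoc]
    exact cons (mul_mem (hJ _ hj) hh) (by rwa [J.mul_mem_cancel_left hj]) hu

theorem exists_of_mem_sup (hJ : ∀ i, J ≤ H i) {w : M ≃ₜ M} (hw : w ∈ H true ⊔ H false) :
    w ∈ J ∨ ∃ i k, AlternatingWord H J i k w := by
  have key : ∀ s, ∀ g ∈ H s, ∀ w, (w ∈ J ∨ ∃ i k, AlternatingWord H J i k w) →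
      (g * w ∈ J ∨ ∃ i k, AlternatingWord H J i k (g * w)) := by
    intro s g hg w hw
    have hH : ∀ h ∈ H s, h ∈ J ∨ ∃ i k, AlternatingWord H J i k h := fun h hh =>
      or_iff_not_imp_left.2 fun hhJ => ⟨s, s, single hh hhJ⟩
    by_cases hgJ : g ∈ J
    · rcases hw with hw | ⟨i, k, hw⟩
      · exact Or.inl (mul_mem hgJ hw)
      · exact Or.inr ⟨i, k, hw.mul_left hJ hgJ⟩
    rcases hw with hw | ⟨i, k, hw⟩
    · exact hH _ (mul_mem hg (hJ _ hw))
    · rcases Bool.eq_or_eq_not i s with rfl | rfl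
      · cases hw with
        | single hh hhJ => exact hH _ (mul_mem hg hh)
        | @cons _ _ h u hh hhJ hu =>
          rw [← mul_assoc]
          by_cases hgh : g * h ∈ J
          · exact Or.inr ⟨_, _, hu.mul_left hJ hgh⟩
          · exact Or.inr ⟨_, _, cons (mul_mem hg hh) hgh hu⟩
      · exact Or.inr ⟨s, k, cons hg hgJ hw⟩
  rw [Subgroup.sup_eq_closure] at hw
  induction hw using Subgroup.closure_induction_left with
  | one => exact Or.inl (one_mem _)
  | mul_left x hx y _ ih =>
    rcases hx with hx | hx
    · exact key _ x hx y ih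
    · exact key _ x hx y ih
  | inv_mul_cancel x hx y _ ih =>
    rcases hx with hx | hx
    · exact key _ x⁻¹ (inv_mem hx) y ih
    · exact key _ x⁻¹ (inv_mem hx) y ih

theorem exists_apply_mem {B : Bool → Set M} (hB : AmalgamPosition H J B) {i k : Bool}
    {w : M ≃ₜ M} (hw : AlternatingWord H J i k w) :
    ∃ g ∈ H i, g ∉ J ∧ ∀ x ∈ B k, g⁻¹ (w x) ∈ B i := by
  induction hw with
  | @single i g hg hgJ => exact ⟨g, hg, hgJ, fun x hx => by rwa [homeo_inv_apply_self]⟩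
  | @cons i k g u hg hgJ _ ih =>
    obtain ⟨h, hh, hhJ, hx⟩ := ih
    refine ⟨g, hg, hgJ, fun x hxk => ?_⟩
    rw [homeo_mul_apply, homeo_inv_apply_self]
    have := interior_subset (hB.pp _ h hh hhJ _ (hx x hxk))
    rwa [homeo_apply_inv_self, Bool.not_not] at this

end AlternatingWord

namespace AmalgamPosition

variable {H : Bool → Subgroup (M ≃ₜ M)} {J : Subgroup (M ≃ₜ M)} {B : Bool → Set M}

theorem disjoint_interior (hB : AmalgamPosition H J B) (i : Bool) :
    Disjoint (interior (B i)) (interior (B !i)) :=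
  (hB.disjoint i).mono_left interior_subset

theorem mem_limitSet_of_mem (hB : AmalgamPosition H J B) {i : Bool} {x : M}
    (hx : x ∈ limitSet (H i)) (hxB : x ∈ B i) : x ∈ limitSet J := by
  by_contra h
  exact (hB.disjoint i).le_bot ⟨hxB, hB.lim i x hx h⟩

theorem mem_of_apply_mem_interior (hB : AmalgamPosition H J B) {i : Bool} {g : M ≃ₜ M}
    (hg : g ∈ H i) {x : M} (hx : x ∈ B i) (hgx : g x ∈ interior (B i)) : g ∈ J := by
  by_contra h
  exact (hB.disjoint_interior i).le_bot ⟨hgx, hB.pp i g hg h x hx⟩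

variable [CompactSpace M] [T2Space M]

theorem limitSet_subset (hB : AmalgamPosition H J B) (i : Bool) : limitSet J ⊆ B i := by
  rintro x ⟨g, hg, hi, zm, hc⟩
  have := infinite_of_injective_homeo hi
  exact hc.mem_of_frequently isOpen_interior (hB.nonempty i) (hB.isClosed i)
    (Frequently.of_forall fun k x hx => hB.inv i _ (hg k) x (interior_subset hx))

theorem apply_notMem_limitSet (hB : AmalgamPosition H J B) {i : Bool} {g : M ≃ₜ M}
    (hg : g ∈ H i) (hgJ : g ∉ J) {x : M} (hx : x ∈ limitSet J) : g x ∉ limitSet J := fun h =>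
  (hB.disjoint i).le_bot
    ⟨hB.limitSet_subset i h, hB.pp i g hg hgJ x (hB.limitSet_subset i hx)⟩

theorem exists_three_cosets (hB : AmalgamPosition H J B) {i : Bool}
    {p : M} (hp : p ∈ limitSet (H i)) :
    ∃ a ∈ H i, ∃ b ∈ H i, a ∉ J ∧ b ∉ J ∧ a⁻¹ * b ∉ J := by
  by_contra! hcon
  obtain ⟨a, ha, haJ⟩ := hB.exists_notMem i
  have hsub : ∀ x ∈ limitSet (H i), x ∈ limitSet J := by
    rintro x ⟨g, hg, hi, zm, hc⟩
    by_cases hf : ∃ᶠ k in atTop, g k ∈ J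
    · obtain ⟨φ, hφ, hφJ⟩ := extraction_of_frequently_atTop hf
      exact ⟨g ∘ φ, hφJ, hi.comp hφ.injective, zm, hc.comp hφ.tendsto_atTop⟩
    · obtain ⟨N, hN⟩ := eventually_atTop.1 (not_frequently.1 hf)
      refine ⟨fun k => g (k + N) * a, fun k => ?_, fun k l hkl => ?_, _,
        (hc.comp (tendsto_add_atTop_nat N)).mul_right a⟩
      · have := hcon (g (k + N))⁻¹ (inv_mem (hg _)) a ha
          (by rw [inv_mem_iff]; exact hN _ (by omega)) haJ
        rwa [inv_inv] at this
      · have := hi (mul_right_cancel hkl)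
        omega
  exact hB.apply_notMem_limitSet ha haJ (hsub p hp) (hsub _ (apply_mem_limitSet ha hp))

end AmalgamPosition

theorem TendstoHomeo.eventually_inv_mul_apply_mem [CompactSpace M] [T2Space M] {g : ℕ → M ≃ₜ M}
    (hg : TendstoHomeo g) {U : Set M} (hU : IsOpen U) {u : M} (hu : u ∈ U) :
    ∀ᶠ N in atTop, ∀ k ≥ N, ∀ l ≥ N, (g k)⁻¹ (g l u) ∈ U := by
  obtain ⟨f, hf⟩ := hg
  rw [ContinuousMap.tendsto_nhds_compactOpen] at hf
  have hfU : f '' U ∈ 𝓝 (f u) := (f.isOpenMap U hU).mem_nhds (mem_image_of_mem f hu)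
  obtain ⟨W, hW, hWc, hWU⟩ := exists_mem_nhds_isClosed_subset hfU
  have h1 := hf Uᶜ hU.isClosed_compl.isCompact Wᶜ hWc.isOpen_compl (by
    intro x hx hxW
    obtain ⟨y, hy, hyx⟩ := hWU hxW
    exact hx (f.injective hyx ▸ hy))
  have h2 := hf {u} isCompact_singleton (interior W) isOpen_interior (by
    rintro _ rfl
    exact mem_interior_iff_mem_nhds.2 hW)
  obtain ⟨N, hN⟩ := eventually_atTop.1 (h1.and h2)
  filter_upwards [eventually_ge_atTop N] with n hn k hk l hl
  by_contra hc
  have h3 : g k ((g k)⁻¹ (g l u)) ∈ Wᶜ := (hN k (hn.trans hk)).1 hc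
  rw [homeo_apply_inv_self] at h3
  exact h3 (interior_subset ((hN l (hn.trans hl)).2 rfl))

/-- The amalgam of two discrete convergence groups acts as a discrete convergence group as soon
as it acts as a convergence group. -/
theorem AmalgamPosition.isDiscreteConvGroup [CompactSpace M] [T2Space M]
    {H : Bool → Subgroup (M ≃ₜ M)} {J G : Subgroup (M ≃ₜ M)} {B : Bool → Set M}
    (hB : AmalgamPosition H J B) (hG : ∀ w ∈ G, w ∈ J ∨ ∃ i k, AlternatingWord H J i k w)
    (hconv : IsConvGroup G) {i : Bool} {p : M} (hp : p ∈ limitSet (H i)) :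
    IsDiscreteConvGroup G := by
  obtain ⟨a, ha, b, hb, haJ, hbJ, hab⟩ := hB.exists_three_cosets hp
  choose e he using hB.nonempty
  have hmix : ∀ w, AlternatingWord H J i (!i) w → a⁻¹ (w (a (e i))) ∈ interior (B i) →
      b⁻¹ (w (b (e i))) ∈ interior (B i) → False := by
    intro w hw h1 h2
    obtain ⟨g, hg, hgJ, hgw⟩ := hw.exists_apply_mem hB
    have key : ∀ a ∈ H i, a ∉ J → a⁻¹ (w (a (e i))) ∈ interior (B i) → a⁻¹ * g ∈ J := by
      intro a ha haJ h1
      refine hB.mem_of_apply_mem_interior (mul_mem (inv_mem ha) hg)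
        (hgw (a (e i)) (interior_subset (hB.pp i a ha haJ _ (interior_subset (he i))))) ?_
      rwa [homeo_mul_apply, homeo_apply_inv_self]
    apply hab
    have := mul_mem (key a ha haJ h1) (inv_mem (key b hb hbJ h2))
    simpa using this
  have hJw : ∀ w ∈ G, (∀ s, w (e s) ∈ interior (B s)) →
      (∀ c, c = a ∨ c = b → c⁻¹ (w (c (e i))) ∈ interior (B i) ∧
        c⁻¹ (w⁻¹ (c (e i))) ∈ interior (B i)) → w ∈ J := by
    intro w hw h1 h2
    rcases hG w hw with h | ⟨s, k, h⟩
    · exact h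
    exfalso
    rcases Bool.eq_or_eq_not k s with rfl | rfl
    · obtain ⟨g, hg, hgJ, hgw⟩ := h.exists_apply_mem hB
      have := hB.pp _ g hg hgJ _ (hgw (e k) (interior_subset (he k)))
      rw [homeo_apply_inv_self] at this
      exact (hB.disjoint_interior k).le_bot ⟨h1 k, this⟩
    · rcases Bool.eq_or_eq_not s i with rfl | rfl
      · exact hmix w h (h2 a (Or.inl rfl)).1 (h2 b (Or.inr rfl)).1
      · have h' := h.inv
        rw [Bool.not_not] at h'
        exact hmix _ h' (h2 a (Or.inl rfl)).2 (h2 b (Or.inr rfl)).2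
  intro g hg hi
  obtain ⟨φ, hφ, hlim | h⟩ := hconv g hg hi
  · have hc : ∀ c : M ≃ₜ M, ∀ᶠ N in atTop, ∀ k ≥ N, ∀ l ≥ N,
        c⁻¹ (((g ∘ φ) k)⁻¹ ((g ∘ φ) l (c (e i)))) ∈ interior (B i) := by
      intro c
      exact hlim.eventually_inv_mul_apply_mem (U := (c⁻¹ : M ≃ₜ M) ⁻¹' interior (B i))
        (isOpen_interior.preimage (c⁻¹ : M ≃ₜ M).continuous)
        (by rw [mem_preimage, homeo_inv_apply_self]; exact he i)
    obtain ⟨N, ⟨hN1, hN2⟩, hN3, hN4⟩ := (((hc a).and (hc b)).and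
      ((hlim.eventually_inv_mul_apply_mem isOpen_interior (he true)).and
        (hlim.eventually_inv_mul_apply_mem isOpen_interior (he false)))).exists
    have hmem : ∀ l, (g (φ N))⁻¹ * g (φ (N + l)) ∈ J := by
      intro l
      refine hJw _ (mul_mem (inv_mem (hg _)) (hg _)) ?_ ?_
      · rintro (_ | _)
        · exact hN4 N le_rfl (N + l) (by omega)
        · exact hN3 N le_rfl (N + l) (by omega)
      · rintro c (rfl | rfl)
        · refine ⟨hN1 N le_rfl (N + l) (by omega), ?_⟩
          rw [mul_inv_rev, inv_inv]
          exact hN1 (N + l) (by omega) N le_rfl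
        · refine ⟨hN2 N le_rfl (N + l) (by omega), ?_⟩
          rw [mul_inv_rev, inv_inv]
          exact hN2 (N + l) (by omega) N le_rfl
    obtain ⟨ψ, hψ, zp, zm, h⟩ := (hB.discrete i).mono (hB.le i) _ hmem fun k l hkl => by
      have := hφ.injective (hi (mul_left_cancel hkl))
      omega
    refine ⟨fun k => φ (N + ψ k), fun k l hkl => hφ (Nat.add_lt_add_left (hψ hkl) N),
      g (φ N) zp, zm, ?_⟩
    have := h.mul_left (g (φ N))
    simpa [Function.comp_def] using this
  · exact ⟨φ, hφ, h⟩

end Amalgam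

section BoundedParabolic

variable {M : Type*} [TopologicalSpace M]

theorem IsConicalLimitPt.apply {G : Subgroup (M ≃ₜ M)} {x : M} (hx : IsConicalLimitPt G x)
    {a : M ≃ₜ M} (ha : a ∈ G) : IsConicalLimitPt G (a x) := by
  obtain ⟨g, hg, hi, h⟩ := hx
  refine ⟨fun k => g k * a⁻¹, fun k => mul_mem (hg k) (inv_mem ha),
    fun k l hkl => hi (mul_right_cancel hkl), fun z hz => ?_⟩
  obtain ⟨K, hK, hKd, hgK⟩ := h (a⁻¹ z) fun hc => hz ((homeo_inv_eq_iff a).1 hc)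
  refine ⟨K, hK, hKd, fun k => ?_⟩
  rw [homeo_mul_apply, homeo_mul_apply, homeo_inv_apply_self]
  exact hgK k

theorem AlternatingWord.mem_limitSet_or_exists_isConvSeq
    {H : Bool → Subgroup (M ≃ₜ M)} {J G : Subgroup (M ≃ₜ M)}
    (hG : ∀ w ∈ G, w ∈ J ∨ ∃ i k, AlternatingWord H J i k w) {x : M} (hx : x ∈ limitSet G) :
    x ∈ limitSet J ∨ ∃ w : ℕ → M ≃ₜ M, ∃ zm, IsConvSeq w x zm ∧
      ∃ i k, ∃ᶠ m in atTop, AlternatingWord H J i k (w m) := by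
  obtain ⟨w, hw, hi, zm, hc⟩ := hx
  by_cases hf : ∃ᶠ m in atTop, w m ∈ J
  · obtain ⟨φ, hφ, hφJ⟩ := extraction_of_frequently_atTop hf
    exact Or.inl ⟨w ∘ φ, hφJ, hi.comp hφ.injective, zm, hc.comp hφ.tendsto_atTop⟩
  · refine Or.inr ⟨w, zm, hc, ?_⟩
    by_contra! hcon
    have h1 := eventually_all.2 fun i => eventually_all.2 (hcon i)
    obtain ⟨m, hm, hmJ⟩ := (h1.and (not_frequently.1 hf)).exists
    obtain h | ⟨i, k, h⟩ := hG (w m) (hw m)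
    exacts [hmJ h, hm i k h]

/-- The limit set of `H i` together with the translates `g (B i)`, where `g` ranges over the
elements of `H i` such that `p` is not in the translate `g Λ(J)`. -/
def shadow (H : Bool → Subgroup (M ≃ₜ M)) (J : Subgroup (M ≃ₜ M)) (B : Bool → Set M) (i : Bool)
    (p : M) : Set M :=
  limitSet (H i) ∪ {x | ∃ g ∈ H i, g⁻¹ p ∉ limitSet J ∧ g⁻¹ x ∈ B i}

namespace AmalgamPosition

variable [CompactSpace M] [TopologicalSpace.MetrizableSpace M]
variable {H : Bool → Subgroup (M ≃ₜ M)} {J G : Subgroup (M ≃ₜ M)} {B : Bool → Set M}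

/-- The translates of `p` by `H i` which are not limit points of `J` can be moved by `J` into a
fixed closed set disjoint from `Λ(J)`. -/
theorem exists_isClosed_translates (hB : AmalgamPosition H J B) (hJ : IsGeomFinite J) {i : Bool}
    (hH : IsGeomFinite (H i)) {p : M} (hp : p ∈ limitSet (H i)) :
    ∃ D, IsClosed D ∧ Disjoint D (limitSet J) ∧ ∀ g ∈ H i, g⁻¹ p ∉ limitSet J →
      ∃ g' ∈ H i, g'⁻¹ p ∈ D ∧ ∀ x, g⁻¹ x ∈ B i → g'⁻¹ x ∈ B i := by
  have key := exists_isOpen_limitSet_subset_forall_exists_notMem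
    ((hB.discrete i).mono (hB.le i)) (Z := {z | ∃ g ∈ H i, z = g⁻¹ p ∧ z ∉ limitSet J}) ?_ ?_ ?_
  · obtain ⟨O, hO, hJO, h⟩ := key
    refine ⟨Oᶜ, hO.isClosed_compl, disjoint_compl_left_iff_subset.2 hJO, fun g hg hgp => ?_⟩
    obtain ⟨j, hj, hjO⟩ := h _ ⟨g, hg, rfl, hgp⟩
    refine ⟨g * j⁻¹, mul_mem hg (inv_mem (hB.le i hj)), ?_, fun x hx => ?_⟩
    · rwa [mul_inv_rev, inv_inv]
    · rw [mul_inv_rev, inv_inv]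
      exact hB.inv i j hj _ hx
  · rw [Set.disjoint_left]
    rintro z ⟨g, -, -, hz⟩
    exact hz
  · rintro j hj z ⟨g, hg, rfl, hz⟩
    refine ⟨g * j⁻¹, mul_mem hg (inv_mem (hB.le i hj)), ?_, ?_⟩
    · rw [mul_inv_rev, inv_inv, homeo_mul_apply]
    · rwa [apply_mem_limitSet_iff hj]
  · intro b hb
    by_cases hbc : IsConicalLimitPt J b
    · exact Or.inl hbc
    have hbp := ((hJ b hb).resolve_left hbc).1
    have hbH : IsParabolicPt (H i) b := by
      obtain ⟨g, hg, h⟩ := hbp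
      exact ⟨g, hB.le i hg, h⟩
    obtain ⟨-, K, hK, hKb, hKH⟩ := (hH b (limitSet_mono (hB.le i) hb)).resolve_left
      (hbH.not_isConicalLimitPt (hB.discrete i))
    refine Or.inr ⟨hbc, hbp, K, hK.isClosed, fun hbK => (hKb hbK).2 rfl, ?_⟩
    rintro z ⟨g, hg, rfl, hz⟩
    obtain ⟨h, hh, hhb, hhz⟩ := hKH _ ⟨apply_mem_limitSet (inv_mem hg) hp, fun hc => hz (hc ▸ hb)⟩
    refine ⟨h, ?_, hhb, hhz⟩
    by_contra hhJ
    exact hB.apply_notMem_limitSet hh hhJ hb (hhb.symm ▸ hb)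

theorem repelling_mem_and_notMem (hB : AmalgamPosition H J B) {i : Bool} {p : M}
    (hnc : ¬ IsConicalLimitPt (H i) p) {D : Set M} (hD : IsClosed D)
    (hDJ : Disjoint D (limitSet J)) {f : ℕ → M ≃ₜ M} (hf : ∀ k, f k ∈ H i)
    (hi : Function.Injective f) (hfD : ∀ k, (f k)⁻¹ p ∈ D) {a b : M} (h : IsConvSeq f a b) :
    b ∈ D ∧ b ∉ B i := by
  have hbD := hD.mem_of_tendsto (h.tendsto_inv_apply_of_not_conical hnc hf hi)
    (Eventually.of_forall hfD)
  exact ⟨hbD, fun hb => hDJ.le_bot ⟨hbD, hB.mem_limitSet_of_mem (h.mem_limitSet' hf hi) hb⟩⟩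

theorem tendsto_apply_of_mem (hB : AmalgamPosition H J B) {i : Bool} {f : ℕ → M ≃ₜ M} {a b : M}
    (h : IsConvSeq f a b) (hb : b ∉ B i) {y : ℕ → M} (hy : ∀ k, y k ∈ B i) :
    Tendsto (fun k => f k (y k)) atTop (𝓝 a) := by
  intro U hU
  change ∀ᶠ k in atTop, f k (y k) ∈ U
  filter_upwards [h.eventually hU ((hB.isClosed i).isOpen_compl.mem_nhds hb)] with k hk
  exact hk _ fun hc => hc (hy k)

theorem exists_isConvSeq_of_tendsto (hB : AmalgamPosition H J B) {i : Bool} {p : M}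
    (hp : p ∈ limitSet (H i)) (hnc : ¬ IsConicalLimitPt (H i) p) {D : Set M} (hD : IsClosed D)
    (hDJ : Disjoint D (limitSet J)) {f : ℕ → M ≃ₜ M} (hf : ∀ k, f k ∈ H i)
    (hfD : ∀ k, (f k)⁻¹ p ∈ D) {y : ℕ → M} (hy : ∀ k, y k ∈ B i)
    (hfy : Tendsto (fun k => f k (y k)) atTop (𝓝 p)) :
    ∃ ψ : ℕ → ℕ, StrictMono ψ ∧ Function.Injective (f ∘ ψ) ∧ ∃ b, IsConvSeq (f ∘ ψ) p b ∧
      Tendsto (fun k => (f (ψ k))⁻¹ p) atTop (𝓝 b) := by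
  obtain ⟨φ, hφ, ⟨c, hc⟩ | hφi⟩ := exists_strictMono_comp_injective_or_const f
  · exfalso
    have hlim : Tendsto (fun k => c⁻¹ (f (φ k) (y (φ k)))) atTop (𝓝 (c⁻¹ p)) :=
      ((c⁻¹ : M ≃ₜ M).continuous.tendsto p).comp (hfy.comp hφ.tendsto_atTop)
    have hcB : c⁻¹ p ∈ B i := (hB.isClosed i).mem_of_tendsto hlim (Eventually.of_forall fun k => by
      rw [hc, homeo_inv_apply_self]; exact hy _)
    have hcH : c ∈ H i := hc 0 ▸ hf (φ 0)
    exact hDJ.le_bot ⟨hc 0 ▸ hfD (φ 0),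
      hB.mem_limitSet_of_mem (apply_mem_limitSet (inv_mem hcH) hp) hcB⟩
  · obtain ⟨ψ, hψ, a, -, b, -, h⟩ := (hB.discrete i).exists_subseq (fun k => hf (φ k)) hφi
    have hinj : Function.Injective fun k => f (φ (ψ k)) := hφi.comp hψ.injective
    obtain ⟨-, hb⟩ := hB.repelling_mem_and_notMem hnc hD hDJ (fun k => hf _) hinj
      (fun k => hfD _) h
    obtain rfl : a = p := tendsto_nhds_unique (hB.tendsto_apply_of_mem h hb fun k => hy (φ (ψ k)))
      (hfy.comp (hφ.comp hψ).tendsto_atTop)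
    exact ⟨φ ∘ ψ, hφ.comp hψ, hinj, b, h,
      h.tendsto_inv_apply_of_not_conical hnc (fun k => hf _) hinj⟩

/-- The stabilizer of a non-conical limit point `p` of `H i` acts cocompactly on the complement of
`p` in its shadow. -/
theorem exists_isClosed_shadow (hB : AmalgamPosition H J B) (hJ : IsGeomFinite J) {i : Bool}
    (hH : IsGeomFinite (H i)) {p : M} (hp : p ∈ limitSet (H i))
    (hnc : ¬ IsConicalLimitPt (H i) p) :
    ∃ C, IsClosed C ∧ p ∉ C ∧ ∀ x ∈ shadow H J B i p, x ≠ p → ∃ h ∈ H i, h p = p ∧ h x ∈ C := by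
  obtain ⟨D, hD, hDJ, hadj⟩ := hB.exists_isClosed_translates hJ hH hp
  obtain ⟨-, K, hK, hKp, hKH⟩ := (hH p hp).resolve_left hnc
  have hpK : p ∉ K := fun h => (hKp h).2 rfl
  by_contra! hcon
  obtain ⟨U, hU, hUb⟩ := (nhds_basis_opens p).exists_antitone_subbasis
  choose x hxS hxp hx using fun n => hcon (K ∪ (U n)ᶜ) (hK.isClosed.union (hU n).2.isClosed_compl)
    (by rintro (h | h); exacts [hpK h, h (hU n).1])
  have hg : ∀ n, ∃ g ∈ H i, g⁻¹ p ∈ D ∧ g⁻¹ (x n) ∈ B i := by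
    intro n
    rcases hxS n with h | ⟨g, hg, hgp, hgx⟩
    · obtain ⟨h, hh, hhp, hhx⟩ := hKH (x n) ⟨h, hxp n⟩
      exact absurd (Or.inl hhx) (hx n h hh hhp)
    · obtain ⟨g', hg', hgD, hgB⟩ := hadj g hg hgp
      exact ⟨g', hg', hgD, hgB _ hgx⟩
  choose g hg hgD hgB using hg
  have hstab : ∀ {h : M ≃ₜ M} (g : M ≃ₜ M), h p = p → (h * g)⁻¹ p = g⁻¹ p := by
    intro h g hp
    rw [mul_inv_rev, homeo_mul_apply, (homeo_inv_eq_iff h).2 hp.symm]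
  have key : ∀ h : ℕ → M ≃ₜ M, (∀ k, h k ∈ H i) → (∀ k, h k p = p) → ∀ φ : ℕ → ℕ, StrictMono φ →
      ∃ ψ : ℕ → ℕ, StrictMono ψ ∧ Function.Injective (fun k => h (ψ k) * g (φ (ψ k))) ∧
        ∃ b, IsConvSeq (fun k => h (ψ k) * g (φ (ψ k))) p b ∧
          Tendsto (fun k => (g (φ (ψ k)))⁻¹ p) atTop (𝓝 b) := by
    intro h hh hhp φ hφ
    obtain ⟨ψ, hψ, hi, b, hc, hlim⟩ := hB.exists_isConvSeq_of_tendsto hp hnc hD hDJ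
      (f := fun k => h k * g (φ k)) (fun k => mul_mem (hh k) (hg _))
      (fun k => by rw [hstab _ (hhp k)]; exact hgD _) (fun k => hgB (φ k)) (by
        refine (hUb.1.tendsto_right_iff).2 fun n _ => ?_
        filter_upwards [eventually_ge_atTop n] with k hk
        rw [homeo_mul_apply, homeo_apply_inv_self]
        by_contra hc
        exact hx (φ k) (h k) (hh k) (hhp k)
          (Or.inr fun hm => hc (hUb.antitone (hk.trans (hφ.id_le k)) hm)))
    refine ⟨ψ, hψ, hi, b, hc, ?_⟩
    simpa only [hstab _ (hhp _)] using hlim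
  obtain ⟨ψ, hψ, hi, b, hc, hlim⟩ := key (fun _ => 1) (fun _ => one_mem _) (fun _ => rfl) id
    strictMono_id
  by_cases hq : ∃ q ∈ limitSet (H i), q ≠ b
  · obtain ⟨q, hqH, hqb⟩ := hq
    obtain ⟨N, hN⟩ := eventually_atTop.1 (hlim.eventually_ne hqb.symm)
    have hex : ∀ k, ∃ h ∈ H i, h p = p ∧ h (g (ψ (k + N)) q) ∈ K := fun k =>
      hKH _ ⟨apply_mem_limitSet (hg _) hqH, fun h =>
        hN (k + N) (by omega) ((homeo_inv_eq_iff _).2 (mem_singleton_iff.1 h).symm)⟩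
    choose h hh hhp hhK using hex
    obtain ⟨θ, hθ, -, b', hc', hlim'⟩ := key h hh hhp (fun k => ψ (k + N))
      fun k l hkl => hψ (by omega)
    have hbb : b' = b := tendsto_nhds_unique hlim'
      ((hlim.comp (tendsto_add_atTop_nat N)).comp hθ.tendsto_atTop)
    exact hpK (hK.isClosed.mem_of_tendsto (hc'.tendsto (hbb ▸ hqb))
      (Eventually.of_forall fun k => hhK (θ k)))
  · push Not at hq
    have hgp : ∀ k, (g k)⁻¹ p = p := fun k =>
      (hq _ (apply_mem_limitSet (inv_mem (hg k)) hp)).trans (hq p hp).symm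
    obtain ⟨θ, -, hθ, -⟩ := key (fun k => (g k)⁻¹) (fun k => inv_mem (hg k)) hgp id strictMono_id
    have : (0 : ℕ) = 1 := hθ (by simp)
    omega

theorem mem_shadow_of_isConvSeq [Infinite M] (hB : AmalgamPosition H J B) (hJ : IsGeomFinite J)
    {i k : Bool} (hH : IsGeomFinite (H i)) {p : M} (hp : p ∈ limitSet (H i))
    (hnc : ¬ IsConicalLimitPt (H i) p) {w : ℕ → M ≃ₜ M} {x zm : M} (hw : IsConvSeq w x zm)
    (hf : ∃ᶠ m in atTop, ∃ g ∈ H i, g⁻¹ p ∉ limitSet J ∧ ∀ y ∈ B k, g⁻¹ (w m y) ∈ B i) :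
    x ∈ shadow H J B i p := by
  obtain ⟨D, hD, hDJ, hadj⟩ := hB.exists_isClosed_translates hJ hH hp
  obtain ⟨θ, hθ, hf⟩ := extraction_of_frequently_atTop hf
  have hg : ∀ m, ∃ g ∈ H i, g⁻¹ p ∈ D ∧ ∀ y ∈ B k, g⁻¹ (w (θ m) y) ∈ B i := by
    intro m
    obtain ⟨g, hg, hgp, hgw⟩ := hf m
    obtain ⟨g', hg', hgD, hgB⟩ := hadj g hg hgp
    exact ⟨g', hg', hgD, fun y hy => hgB _ (hgw y hy)⟩
  choose g hg hgD hgB using hg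
  obtain ⟨c, hcB, hc⟩ := hw.exists_ne_mem isOpen_interior (hB.nonempty k)
  have hlim := (hw.tendsto hc).comp hθ.tendsto_atTop
  obtain ⟨φ, hφ, ⟨a, ha⟩ | hφi⟩ := exists_strictMono_comp_injective_or_const g
  · have haD : a⁻¹ p ∈ D := ha 0 ▸ hgD (φ 0)
    refine Or.inr ⟨a, ha 0 ▸ hg (φ 0), fun h => hDJ.le_bot ⟨haD, h⟩, ?_⟩
    exact (hB.isClosed i).mem_of_tendsto
      (((a⁻¹ : M ≃ₜ M).continuous.tendsto x).comp (hlim.comp hφ.tendsto_atTop))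
      (Eventually.of_forall fun m => ha m ▸ hgB (φ m) c (interior_subset hcB))
  · obtain ⟨ψ, hψ, a, haH, b, -, h⟩ := (hB.discrete i).exists_subseq (fun k => hg (φ k)) hφi
    obtain ⟨-, hb⟩ := hB.repelling_mem_and_notMem hnc hD hDJ (fun k => hg _)
      (hφi.comp hψ.injective) (fun k => hgD _) h
    have hlim' := hB.tendsto_apply_of_mem h hb
      fun m => hgB (φ (ψ m)) c (interior_subset hcB)
    simp only [homeo_apply_inv_self] at hlim'
    rw [tendsto_nhds_unique (hlim.comp (hφ.comp hψ).tendsto_atTop) hlim']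
    exact Or.inl haH

theorem exists_isClosed_of_forall_notMem (hB : AmalgamPosition H J B) (hJ : IsGeomFinite J)
    {i : Bool} (hH : IsGeomFinite (H i)) (hHG : H i ≤ G)
    (hG : ∀ w ∈ G, w ∈ J ∨ ∃ i k, AlternatingWord H J i k w) {p : M} (hp : p ∈ limitSet (H i))
    (hnc : ¬ IsConicalLimitPt (H i) p) (hpJ : ∀ g ∈ H i, g⁻¹ p ∉ limitSet J) :
    ∃ C, IsClosed C ∧ p ∉ C ∧ ∀ x ∈ limitSet G, x ≠ p → ∃ h ∈ G, h p = p ∧ h x ∈ C := by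
  have := infinite_of_mem_limitSet hp
  obtain ⟨C, hC, hpC, h⟩ := hB.exists_isClosed_shadow hJ hH hp hnc
  refine ⟨C, hC, hpC, fun x hx hxp => ?_⟩
  suffices x ∈ shadow H J B i p by
    obtain ⟨a, ha, hap, hax⟩ := h x this hxp
    exact ⟨a, hHG ha, hap, hax⟩
  obtain hxJ | ⟨w, zm, hw, s, k, hf⟩ := AlternatingWord.mem_limitSet_or_exists_isConvSeq hG hx
  · exact Or.inl (limitSet_mono (hB.le i) hxJ)
  refine hB.mem_shadow_of_isConvSeq hJ (k := k) hH hp hnc hw (hf.mono fun m hm => ?_)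
  obtain ⟨g, hg, hgJ, hgw⟩ := hm.exists_apply_mem hB
  rcases Bool.eq_or_eq_not s i with rfl | rfl
  · exact ⟨g, hg, hpJ g hg, hgw⟩
  · refine ⟨1, one_mem _, hpJ 1 (one_mem _), fun y hy => ?_⟩
    have := interior_subset (hB.pp _ g hg hgJ _ (hgw y hy))
    rwa [homeo_apply_inv_self, Bool.not_not] at this

theorem exists_isClosed_of_mem_limitSet (hB : AmalgamPosition H J B) (hJ : IsGeomFinite J)
    (hH : ∀ i, IsGeomFinite (H i)) (hHG : ∀ i, H i ≤ G)
    (hG : ∀ w ∈ G, w ∈ J ∨ ∃ i k, AlternatingWord H J i k w) {p : M} (hp : p ∈ limitSet J)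
    (hnc : ¬ IsConicalLimitPt G p) :
    ∃ C, IsClosed C ∧ p ∉ C ∧ ∀ x ∈ limitSet G, x ≠ p → ∃ h ∈ G, h p = p ∧ h x ∈ C := by
  have := infinite_of_mem_limitSet hp
  have hpH : ∀ i, p ∈ limitSet (H i) := fun i => limitSet_mono (hB.le i) hp
  have hncH : ∀ i, ¬ IsConicalLimitPt (H i) p := fun i h => hnc (h.mono (hHG i))
  choose C hC hpC h using fun i => hB.exists_isClosed_shadow hJ (hH i) (hpH i) (hncH i)
  refine ⟨⋃ i, C i, isClosed_iUnion_of_finite hC, by simpa using ⟨hpC false, hpC true⟩,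
    fun x hx hxp => ?_⟩
  suffices ∃ i, x ∈ shadow H J B i p by
    obtain ⟨i, hi⟩ := this
    obtain ⟨a, ha, hap, hax⟩ := h i x hi hxp
    exact ⟨a, hHG i ha, hap, mem_iUnion.2 ⟨i, hax⟩⟩
  obtain hxJ | ⟨w, zm, hw, s, k, hf⟩ := AlternatingWord.mem_limitSet_or_exists_isConvSeq hG hx
  · exact ⟨true, Or.inl (limitSet_mono (hB.le _) hxJ)⟩
  refine ⟨s, hB.mem_shadow_of_isConvSeq hJ (k := k) (hH s) (hpH s) (hncH s) hw
    (hf.mono fun m hm => ?_)⟩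
  obtain ⟨g, hg, hgJ, hgw⟩ := hm.exists_apply_mem hB
  exact ⟨g, hg, hB.apply_notMem_limitSet (inv_mem hg) (by rwa [inv_mem_iff]) hp, hgw⟩

theorem exists_isClosed_of_not_isConicalLimitPt (hB : AmalgamPosition H J B)
    (hJ : IsGeomFinite J) (hH : ∀ i, IsGeomFinite (H i)) (hHG : ∀ i, H i ≤ G)
    (hG : ∀ w ∈ G, w ∈ J ∨ ∃ i k, AlternatingWord H J i k w) {i : Bool} {p : M}
    (hp : p ∈ limitSet (H i)) (hnc : ¬ IsConicalLimitPt G p) :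
    ∃ C, IsClosed C ∧ p ∉ C ∧ ∀ x ∈ limitSet G, x ≠ p → ∃ h ∈ G, h p = p ∧ h x ∈ C := by
  by_cases hpJ : ∀ g ∈ H i, g⁻¹ p ∉ limitSet J
  · exact hB.exists_isClosed_of_forall_notMem hJ (hH i) (hHG i) hG hp
      (fun h => hnc (h.mono (hHG i))) hpJ
  push Not at hpJ
  obtain ⟨g, hg, hgp⟩ := hpJ
  have hgG := hHG i hg
  obtain ⟨C, hC, hpC, h⟩ := hB.exists_isClosed_of_mem_limitSet hJ hH hHG hG hgp fun hc =>
    hnc (by simpa only [homeo_apply_inv_self] using hc.apply hgG)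
  refine ⟨(g⁻¹ : M ≃ₜ M) ⁻¹' C, hC.preimage (g⁻¹ : M ≃ₜ M).continuous, hpC, fun x hx hxp => ?_⟩
  obtain ⟨a, ha, hap, hax⟩ := h _ (apply_mem_limitSet (inv_mem hgG) hx)
    fun hc => hxp ((g⁻¹ : M ≃ₜ M).injective hc)
  refine ⟨g * a * g⁻¹, mul_mem (mul_mem hgG ha) (inv_mem hgG), ?_, ?_⟩
  · rw [homeo_mul_apply, homeo_mul_apply, hap, homeo_apply_inv_self]
  · rwa [mem_preimage, homeo_mul_apply, homeo_mul_apply, homeo_inv_apply_self]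

end AmalgamPosition

theorem AFPPingPong.amalgamPosition {G₁ G₂ J : Subgroup (M ≃ₜ M)} {B₁ B₂ : Set M}
    (h : AFPPingPong G₁ G₂ J B₁ B₂) (hd₁ : IsDiscreteConvGroup G₁) (hd₂ : IsDiscreteConvGroup G₂)
    (hJ₁ : J < G₁) (hJ₂ : J < G₂) :
    AmalgamPosition (fun i => bif i then G₁ else G₂) J
      (fun i => bif i then closure (interior B₁) else closure (interior B₂)) := by
  have hsub : ∀ {B : Set M}, IsClosed B → closure (interior B) ⊆ B := fun hB =>
    closure_minimal interior_subset hB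
  have h_interior : ∀ {B : Set M}, interior B ⊆ interior (closure (interior B)) := fun {B} =>
    interior_maximal subset_closure isOpen_interior
  have h_interior_eq : ∀ {B : Set M}, IsClosed B → interior (closure (interior B)) = interior B :=
    fun hB => (interior_mono (hsub hB)).antisymm h_interior
  have hinv : ∀ {B : Set M} {j : M ≃ₜ M}, j '' B = B →
      ∀ x ∈ closure (interior B), j x ∈ closure (interior B) := by
    intro B j hj x hx
    have := mem_image_of_mem j hx
    rwa [j.image_closure, j.image_interior, hj] at this
  have hdisj : ∀ {B B' : Set M}, interior B ∩ interior B' = ∅ → IsClosed B' →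
      Disjoint (closure (interior B)) (interior (closure (interior B'))) := by
    intro B B' hd hB'
    rw [h_interior_eq hB']
    exact (disjoint_iff_inter_eq_empty.2 hd).closure_left isOpen_interior
  constructor
  · rintro (_ | _)
    exacts [hd₂, hd₁]
  · rintro (_ | _)
    exacts [hJ₂.le, hJ₁.le]
  · rintro (_ | _)
    exacts [SetLike.exists_of_lt hJ₂, SetLike.exists_of_lt hJ₁]
  · rintro (_ | _) <;> exact isClosed_closure
  · rintro (_ | _)
    exacts [h.int_nonempty₂.mono h_interior, h.int_nonempty₁.mono h_interior]
  · rintro (_ | _)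
    exacts [hdisj (inter_comm _ _ ▸ h.int_disjoint) h.isClosed₁, hdisj h.int_disjoint h.isClosed₂]
  · rintro (_ | _) j hj
    exacts [hinv (h.inv₂ j hj), hinv (h.inv₁ j hj)]
  · rintro (_ | _) g hg hgJ x hx
    exacts [h_interior (h.pp₂ g hg hgJ (mem_image_of_mem g (hsub h.isClosed₂ hx))),
      h_interior (h.pp₁ g hg hgJ (mem_image_of_mem g (hsub h.isClosed₁ hx)))]
  · rintro (_ | _) x hx hxJ
    exacts [h_interior (h.lim₂ ⟨hx, hxJ⟩), h_interior (h.lim₁ ⟨hx, hxJ⟩)]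

end BoundedParabolic

/-- If both `G₁` and `G₂` are geometrically finite, then every
parabolic point of `G` lying in `Λ(G₁) ∪ Λ(G₂)` is a bounded parabolic point for the
action of `G` on `Λ(G)`. -/
theorem statement_17 {M : Type*} [TopologicalSpace M] [CompactSpace M]
    [TopologicalSpace.MetrizableSpace M]
    (G₁ G₂ J G : Subgroup (M ≃ₜ M))
    (hd₁ : IsDiscreteConvGroup G₁) (hd₂ : IsDiscreteConvGroup G₂)
    (hJ : J = G₁ ⊓ G₂) (hJgf : IsGeomFinite J) (hJlt₁ : J < G₁) (hJlt₂ : J < G₂)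
    (hpp : ∃ B₁ B₂ : Set M, AFPPingPong G₁ G₂ J B₁ B₂)
    (hG : G = G₁ ⊔ G₂) (hGconv : IsConvGroup G)
    (hgf₁ : IsGeomFinite G₁) (hgf₂ : IsGeomFinite G₂)
    (p : M) (hp : p ∈ limitSet G₁ ∪ limitSet G₂) (hpar : IsParabolicPt G p) :
    IsBoundedParabolicPt G p := by
  obtain ⟨B₁, B₂, hB⟩ := hpp
  have hB := hB.amalgamPosition hd₁ hd₂ hJlt₁ hJlt₂
  obtain ⟨i, hi⟩ : ∃ i : Bool, p ∈ limitSet (bif i then G₁ else G₂) := by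
    rcases hp with h | h
    exacts [⟨true, h⟩, ⟨false, h⟩]
  have hwords : ∀ w ∈ G, w ∈ J ∨ ∃ i k,
      AlternatingWord (fun i : Bool => bif i then G₁ else G₂) J i k w := fun w hw =>
    AlternatingWord.exists_of_mem_sup hB.le (by rw [hG] at hw; exact hw)
  have hGd := hB.isDiscreteConvGroup hwords hGconv (i := i) hi
  obtain ⟨C, hC, hpC, h⟩ := hB.exists_isClosed_of_not_isConicalLimitPt hJgf
    (by rintro (_ | _); exacts [hgf₂, hgf₁])
    (by rintro (_ | _) <;> rw [hG]; exacts [le_sup_right, le_sup_left]) hwords (i := i) hi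
    (hpar.not_isConicalLimitPt hGd)
  refine ⟨hpar, C ∩ limitSet G, (hC.inter (isClosed_limitSet hGd)).isCompact,
    fun x hx => ⟨hx.2, fun hxp => hpC (hxp ▸ hx.1)⟩, fun x hx => ?_⟩
  obtain ⟨a, ha, hap, hax⟩ := h x hx.1 hx.2
  exact ⟨a, ha, hap, hax, apply_mem_limitSet ha hx.1⟩

end ConvergenceGroups
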